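/- arXiv:2008.13224 — 3 statements merged into one kernel-verified Lean document; each statement's English description precedes it below -/
import Mathlib

section
/- Let k_1 ≥ k_2 ≥ 2 be integers. Every digraph D with minimum out-degree δ+(D) ≥ k_1 + 3k_2 − 5 contains a subdivision of C(k_1,k_2); that is, D contains two distinct vertices x, y and two internally vertex-disjoint directed paths from x to y, one of length at least k_1 and the other of length at least k_2. -/
/- Common definitions: digraphs as irreflexive-in-intent relations `V → V → Prop`,
   directed paths as nonempty duplicate-free lists of vertices,
   subdivisions, gadgets, alternating paths and chains, following
   "Subdivisions in digraphs of large out-degree or large dichromatic number". -/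

namespace Paper

variable {V : Type*}

/-- `p` is a directed path in the digraph `D`: a nonempty list of pairwise distinct
vertices in which consecutive vertices are joined by an arc of `D`.
Its length (number of arcs) is `p.length - 1`. -/
def IsDipathList (D : V → V → Prop) (p : List V) : Prop :=
  p ≠ [] ∧ p.Nodup ∧ p.Chain' D

/-- The out-degree of a vertex. -/
noncomputable def outDeg (D : V → V → Prop) (v : V) : ℕ :=
  Set.ncard {w | D v w}

/-- The digraph `D` contains a subdivision of the digraph `F`: there is an injective
embedding `φ` of the branch vertices and, for every arc `(x,y)` of `F`, a directed path
in `D` from `φ x` to `φ y` of length at least one, such that the internal vertices of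
these paths avoid the branch vertices and the paths of distinct arcs are internally
vertex-disjoint. -/
def ContainsSubdivisionOf {W : Type*} (D : V → V → Prop) (F : W → W → Prop) : Prop :=
  ∃ (φ : W → V) (P : W → W → List V),
    Function.Injective φ ∧
    (∀ ⦃x y⦄, F x y → IsDipathList D (P x y) ∧ (P x y).head? = some (φ x) ∧
      (P x y).getLast? = some (φ y) ∧ 2 ≤ (P x y).length ∧
      ∀ z ∈ (P x y).tail.dropLast, ∀ w, φ w ≠ z) ∧
    (∀ ⦃x y x' y'⦄, F x y → F x' y' → (x, y) ≠ (x', y') →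
      ∀ z ∈ (P x y).tail.dropLast, z ∉ P x' y')

/-- As `ContainsSubdivisionOf`, but moreover the subdivision spans exactly
the vertex set `S`. -/
def SpansSubdivisionOf {W : Type*} (D : V → V → Prop) (S : Set V) (F : W → W → Prop) : Prop :=
  ∃ (φ : W → V) (P : W → W → List V),
    Function.Injective φ ∧
    (∀ ⦃x y⦄, F x y → IsDipathList D (P x y) ∧ (P x y).head? = some (φ x) ∧
      (P x y).getLast? = some (φ y) ∧ 2 ≤ (P x y).length ∧
      ∀ z ∈ (P x y).tail.dropLast, ∀ w, φ w ≠ z) ∧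
    (∀ ⦃x y x' y'⦄, F x y → F x' y' → (x, y) ≠ (x', y') →
      ∀ z ∈ (P x y).tail.dropLast, z ∉ P x' y') ∧
    S = Set.range φ ∪ {z | ∃ x y, F x y ∧ z ∈ P x y}

/-- The biorientation of the triangle minus one arc: vertices `0,1,2` and arcs
`(0,1),(1,0),(1,2),(2,1),(0,2)`. -/
def K3e : Fin 3 → Fin 3 → Prop := fun x y =>
  (x, y) = (0, 1) ∨ (x, y) = (1, 0) ∨ (x, y) = (1, 2) ∨ (x, y) = (2, 1) ∨ (x, y) = (0, 2)

/-- The biorientation of the complete graph on four vertices. -/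
def K4bi : Fin 4 → Fin 4 → Prop := fun x y => x ≠ y

/-- The biorientation of the star with four edges (center `0`). -/
def S4bi : Fin 5 → Fin 5 → Prop := fun x y => x ≠ y ∧ (x = 0 ∨ y = 0)

/-- The orientation of the cycle of length `ℓ` (vertex set `ZMod ℓ`) determined by
`σ`: the edge `{x, x+1}` is oriented from `x` to `x+1` if `σ x = true`, and from
`x+1` to `x` otherwise. -/
def CycleOrientation (ℓ : ℕ) (σ : ZMod ℓ → Bool) : ZMod ℓ → ZMod ℓ → Prop :=
  fun x y => (σ x = true ∧ y = x + 1) ∨ (σ y = false ∧ x = y + 1)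

/-- The oriented cycle `C_{a,b}` on `2ab` vertices: going around the cycle
`ZMod (2ab)`, the arcs of the `j`-th block of `b` consecutive edges are oriented
forwards for even `j` and backwards for odd `j`; its sources are `s_j = 2bj`
and its sinks are `t_j = 2bj + b`, joined by `2a` internally disjoint directed
paths of length `b` each. -/
def Cab (a b : ℕ) : ZMod (2 * a * b) → ZMod (2 * a * b) → Prop := fun x y =>
  ∃ i : ℕ, i < 2 * a * b ∧
    (((i / b) % 2 = 0 ∧ x = (i : ZMod (2 * a * b)) ∧ y = ((i + 1 : ℕ) : ZMod (2 * a * b))) ∨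
     ((i / b) % 2 = 1 ∧ x = ((i + 1 : ℕ) : ZMod (2 * a * b)) ∧ y = (i : ZMod (2 * a * b))))

/-- The directed girth of `D` is at least `g`: every directed cycle
(a nonempty duplicate-free list `v :: p` with consecutive arcs and an arc from the
last vertex back to `v`) has length at least `g`. -/
def DirGirthGE (D : V → V → Prop) (g : ℕ) : Prop :=
  ∀ (v : V) (p : List V), (v :: p).Nodup → List.Chain D v (p ++ [v]) → g ≤ p.length + 1

/-- `D` is strongly connected. -/
def StronglyConnected (D : V → V → Prop) : Prop :=
  ∀ u v : V, Relation.ReflTransGen D u v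

/-- `D` is strongly `k`-arc-connected: after deleting any set of at most `k-1` arcs,
the digraph remains strongly connected. -/
def StronglyArcConnected (D : V → V → Prop) (k : ℕ) : Prop :=
  ∀ E : Finset (V × V), E.card < k →
    StronglyConnected (fun u v => D u v ∧ (u, v) ∉ E)

/-- `x` and `y` are consecutive (in this order) in the list `l`. -/
def adjIn (l : List V) (x y : V) : Prop := ∃ l₁ l₂, l = l₁ ++ x :: y :: l₂

/-- A type-I gadget in `D`: a directed cycle `p, q, rest…` of length at least `g`
through the arc `(p,q)`. -/
structure TypeIGadget (D : V → V → Prop) (g : ℕ) where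
  p : V
  q : V
  rest : List V
  nodup : (p :: q :: rest).Nodup
  chain : List.Chain D p (q :: (rest ++ [p]))
  glen : g ≤ rest.length + 2

def TypeIGadget.verts {D : V → V → Prop} {g : ℕ} (G : TypeIGadget D g) : Set V :=
  {x | x ∈ G.p :: G.q :: G.rest}

def TypeIGadget.arcs {D : V → V → Prop} {g : ℕ} (G : TypeIGadget D g) : V → V → Prop :=
  adjIn (G.p :: G.q :: (G.rest ++ [G.p]))

/-- A basic type-II gadget in `D` (with girth parameter `b`): vertices `p, q, r` and a
directed path `P₁` from `r` to `p` of length at least `2b² + b - 2` avoiding `q`,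
all of whose vertices send an arc to `q`. -/
structure BasicIIGadget (D : V → V → Prop) (b : ℕ) where
  p : V
  q : V
  r : V
  P₁ : List V
  path₁ : IsDipathList D P₁
  first₁ : P₁.head? = some r
  last₁ : P₁.getLast? = some p
  len₁ : 2 * b ^ 2 + b - 1 ≤ P₁.length
  hq : q ∉ P₁
  toq : ∀ x ∈ P₁, D x q

def BasicIIGadget.verts {D : V → V → Prop} {b : ℕ} (G : BasicIIGadget D b) : Set V :=
  insert G.q {x | x ∈ G.P₁}

def BasicIIGadget.arcs {D : V → V → Prop} {b : ℕ} (G : BasicIIGadget D b) :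
    V → V → Prop :=
  fun x y => adjIn G.P₁ x y ∨ (x ∈ G.P₁ ∧ y = G.q)

/-- An extended type-II gadget: a basic type-II gadget together with a directed path
`P₂` of length at least `b` ending at `r`, meeting `P₁` only in `r` and avoiding `q`,
such that either the first vertex of `P₂` sends an arc to the second vertex of `P₁`,
or some vertex of `P₁` other than `r` sends an arc to the first vertex of `P₂`. -/
structure ExtIIGadget (D : V → V → Prop) (b : ℕ) where
  p : V
  q : V
  r : V
  P₁ : List V
  path₁ : IsDipathList D P₁
  first₁ : P₁.head? = some r
  last₁ : P₁.getLast? = some p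
  len₁ : 2 * b ^ 2 + b - 1 ≤ P₁.length
  hq : q ∉ P₁
  toq : ∀ x ∈ P₁, D x q
  P₂ : List V
  path₂ : IsDipathList D P₂
  last₂ : P₂.getLast? = some r
  len₂ : b + 1 ≤ P₂.length
  inter : ∀ x ∈ P₁, x ∈ P₂ → x = r
  hq₂ : q ∉ P₂
  extra : (∃ z y, P₂.head? = some z ∧ P₁[1]? = some y ∧ D z y) ∨
          (∃ w z, w ∈ P₁ ∧ w ≠ r ∧ P₂.head? = some z ∧ D w z)

def ExtIIGadget.verts {D : V → V → Prop} {b : ℕ} (G : ExtIIGadget D b) : Set V :=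
  insert G.q ({x | x ∈ G.P₁} ∪ {x | x ∈ G.P₂})

def ExtIIGadget.arcs {D : V → V → Prop} {b : ℕ} (G : ExtIIGadget D b) : V → V → Prop :=
  fun x y => adjIn G.P₁ x y ∨ (x ∈ G.P₁ ∧ y = G.q) ∨ adjIn G.P₂ x y ∨
    (D x y ∧ ((G.P₂.head? = some x ∧ G.P₁[1]? = some y) ∨
              (x ∈ G.P₁ ∧ x ≠ G.r ∧ G.P₂.head? = some y)))

/-- A type-III gadget: vertices `p, q, r`, the arc `(p,q)`, and two internally
vertex-disjoint directed paths `P₁ : p → r` and `P₂ : q → r`, each of length at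
least `2b - 1`. -/
structure TypeIIIGadget (D : V → V → Prop) (b : ℕ) where
  p : V
  q : V
  r : V
  arc : D p q
  P₁ : List V
  P₂ : List V
  path₁ : IsDipathList D P₁
  path₂ : IsDipathList D P₂
  first₁ : P₁.head? = some p
  first₂ : P₂.head? = some q
  last₁ : P₁.getLast? = some r
  last₂ : P₂.getLast? = some r
  len₁ : 2 * b ≤ P₁.length
  len₂ : 2 * b ≤ P₂.length
  inter : ∀ x ∈ P₁, x ∈ P₂ → x = r

def TypeIIIGadget.verts {D : V → V → Prop} {b : ℕ} (G : TypeIIIGadget D b) : Set V :=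
  {x | x ∈ G.P₁} ∪ {x | x ∈ G.P₂}

def TypeIIIGadget.arcs {D : V → V → Prop} {b : ℕ} (G : TypeIIIGadget D b) :
    V → V → Prop :=
  fun x y => (x = G.p ∧ y = G.q) ∨ adjIn G.P₁ x y ∨ adjIn G.P₂ x y

/-- A trivial gadget: just the arc `(p,q)`. -/
structure TrivGadget (D : V → V → Prop) where
  p : V
  q : V
  arc : D p q

def TrivGadget.verts {D : V → V → Prop} (G : TrivGadget D) : Set V := {G.p, G.q}

def TrivGadget.arcs {D : V → V → Prop} (G : TrivGadget D) : V → V → Prop :=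
  fun x y => x = G.p ∧ y = G.q

/-- An `(a,b)`-alternating path in `D` (with 0-based indexing): vertices
`s 0, …, s (a-1)`, `t 0, …, t (a-1)` and pairwise internally disjoint directed paths
`Q i : s i → t i` and `Q' i : s (i+1) → t i`, forming an oriented path; every `Q' i`
and every `Q i` with `0 < i < a - 1` has length at least `b` (`Q 0` and `Q (a-1)`
may even be single vertices). -/
structure AltPath (D : V → V → Prop) (a b : ℕ) where
  s : Fin a → V
  t : Fin a → V
  Q : Fin a → List V
  Q' : Fin (a - 1) → List V
  path_Q : ∀ i, IsDipathList D (Q i)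
  first_Q : ∀ i, (Q i).head? = some (s i)
  last_Q : ∀ i, (Q i).getLast? = some (t i)
  path_Q' : ∀ i, IsDipathList D (Q' i)
  first_Q' : ∀ i : Fin (a - 1),
    (Q' i).head? = some (s ⟨i.val + 1, by have := i.isLt; omega⟩)
  last_Q' : ∀ i : Fin (a - 1),
    (Q' i).getLast? = some (t ⟨i.val, by have := i.isLt; omega⟩)
  len_Q : ∀ i : Fin a, 0 < i.val → i.val < a - 1 → b + 1 ≤ (Q i).length
  len_Q' : ∀ i, b + 1 ≤ (Q' i).length
  disj_QQ : ∀ i j : Fin a, i ≠ j → ∀ x ∈ Q i, x ∉ Q j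
  disj_Q'Q' : ∀ i j : Fin (a - 1), i ≠ j → ∀ x ∈ Q' i, x ∉ Q' j
  disj_QQ' : ∀ (i : Fin a) (j : Fin (a - 1)), ∀ x ∈ Q i, x ∈ Q' j →
    (j.val = i.val ∧ x = t i) ∨ (i.val = j.val + 1 ∧ x = s i)

def AltPath.verts {D : V → V → Prop} {a b : ℕ} (R : AltPath D a b) : Set V :=
  {x | (∃ i, x ∈ R.Q i) ∨ (∃ i, x ∈ R.Q' i)}

/-- A strong alternating path: additionally `Q 0` and `Q (a-1)` (hence all `Q i`)
have length at least `b`. -/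
def AltPath.Strong {D : V → V → Prop} {a b : ℕ} (R : AltPath D a b) : Prop :=
  ∀ i, b + 1 ≤ (R.Q i).length

def AltPath.arcs {D : V → V → Prop} {a b : ℕ} (R : AltPath D a b) : V → V → Prop :=
  fun x y => (∃ i, adjIn (R.Q i) x y) ∨ (∃ i, adjIn (R.Q' i) x y)

/-- A gadget allowed in a chain: type I (with `g = 4b²`), basic type II, or type III. -/
inductive ChainGadget (D : V → V → Prop) (b : ℕ) where
  | I : TypeIGadget D (4 * b ^ 2) → ChainGadget D b
  | II : BasicIIGadget D b → ChainGadget D b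
  | III : TypeIIIGadget D b → ChainGadget D b

def ChainGadget.pp {D : V → V → Prop} {b : ℕ} : ChainGadget D b → V
  | .I G => G.p
  | .II G => G.p
  | .III G => G.p

def ChainGadget.qq {D : V → V → Prop} {b : ℕ} : ChainGadget D b → V
  | .I G => G.q
  | .II G => G.q
  | .III G => G.q

def ChainGadget.verts {D : V → V → Prop} {b : ℕ} : ChainGadget D b → Set V
  | .I G => G.verts
  | .II G => G.verts
  | .III G => G.verts

def ChainGadget.arcs {D : V → V → Prop} {b : ℕ} : ChainGadget D b → V → V → Prop
  | .I G => G.arcs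
  | .II G => G.arcs
  | .III G => G.arcs

/-- A chain in `D`: a directed path (spine) `v 0, …, v m`, a set `A2` of spine arcs,
and a gadget for every arc in `A2` (arcs outside `A2` form `A1` and carry trivial
gadgets), such that each gadget has the endpoints of its arc as designated vertices,
meets the spine only in these two vertices, and two distinct gadgets meet only in
spine vertices. -/
structure GChain (D : V → V → Prop) (b m : ℕ) where
  v : Fin (m + 1) → V
  inj : Function.Injective v
  spine : ∀ i : Fin m, D (v i.castSucc) (v i.succ)
  A2 : Finset (Fin m)
  gad : (i : Fin m) → i ∈ A2 → ChainGadget D b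
  hp : ∀ (i : Fin m) (hi : i ∈ A2), (gad i hi).pp = v i.castSucc
  hq : ∀ (i : Fin m) (hi : i ∈ A2), (gad i hi).qq = v i.succ
  hspine : ∀ (i : Fin m) (hi : i ∈ A2) (j : Fin (m + 1)),
    v j ∈ (gad i hi).verts → j = i.castSucc ∨ j = i.succ
  hdisj : ∀ (i : Fin m) (hi : i ∈ A2) (j : Fin m) (hj : j ∈ A2), i ≠ j →
    ∀ x, x ∈ (gad i hi).verts → x ∈ (gad j hj).verts → ∃ k, x = v k

def GChain.verts {D : V → V → Prop} {b m : ℕ} (C : GChain D b m) : Set V :=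
  Set.range C.v ∪ {x | ∃ (i : Fin m) (hi : i ∈ C.A2), x ∈ (C.gad i hi).verts}

def GChain.arcs {D : V → V → Prop} {b m : ℕ} (C : GChain D b m) : V → V → Prop :=
  fun x y => (∃ i : Fin m, x = C.v i.castSucc ∧ y = C.v i.succ) ∨
    (∃ (i : Fin m) (hi : i ∈ C.A2), (C.gad i hi).arcs x y)

/-- The vertex set of the gadget `G_e` sitting on the `i`-th spine arc
(the trivial gadget for arcs of `A1`). -/
def GChain.gadVerts {D : V → V → Prop} {b m : ℕ} (C : GChain D b m) (i : Fin m) :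
    Set V :=
  if h : i ∈ C.A2 then (C.gad i h).verts else {C.v i.castSucc, C.v i.succ}

/-- An arbitrary gadget: trivial, type I (with `g = 4b²`), basic or extended type II,
or type III. -/
inductive GadgetAny (D : V → V → Prop) (b : ℕ) where
  | triv : TrivGadget D → GadgetAny D b
  | I : TypeIGadget D (4 * b ^ 2) → GadgetAny D b
  | II : BasicIIGadget D b → GadgetAny D b
  | IIext : ExtIIGadget D b → GadgetAny D b
  | III : TypeIIIGadget D b → GadgetAny D b

def GadgetAny.pp {D : V → V → Prop} {b : ℕ} : GadgetAny D b → V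
  | .triv G => G.p
  | .I G => G.p
  | .II G => G.p
  | .IIext G => G.p
  | .III G => G.p

def GadgetAny.qq {D : V → V → Prop} {b : ℕ} : GadgetAny D b → V
  | .triv G => G.q
  | .I G => G.q
  | .II G => G.q
  | .IIext G => G.q
  | .III G => G.q

def GadgetAny.verts {D : V → V → Prop} {b : ℕ} : GadgetAny D b → Set V
  | .triv G => G.verts
  | .I G => G.verts
  | .II G => G.verts
  | .IIext G => G.verts
  | .III G => G.verts

def GadgetAny.arcs {D : V → V → Prop} {b : ℕ} : GadgetAny D b → V → V → Prop
  | .triv G => G.arcs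
  | .I G => G.arcs
  | .II G => G.arcs
  | .IIext G => G.arcs
  | .III G => G.arcs

end Paper

namespace Paper

section Helpers

variable {V : Type*}

theorem outDeg_le_length [Fintype V] (D : V → V → Prop) (v : V) (l : List V)
    (h : ∀ w, D v w → w ∈ l) : outDeg D v ≤ l.length := by
  classical
  unfold outDeg
  calc Set.ncard {w | D v w} ≤ Set.ncard (↑l.toFinset : Set V) := by
        apply Set.ncard_le_ncard
        · intro w hw; simpa using h w hw
        · exact Finset.finite_toSet _
    _ = l.toFinset.card := Set.ncard_coe_finset _
    _ ≤ l.length := List.toFinset_card_le l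

theorem mem_drop_take (A B : List V) (t : V) (a k : ℕ) (h1 : a ≤ A.length)
    (h2 : A.length < a + k) : t ∈ ((A ++ t :: B).drop a).take k := by
  rw [List.drop_append_of_le_length h1, List.take_append]
  apply List.mem_append_right
  have : 0 < k - (A.drop a).length := by simp; omega
  obtain ⟨m, hm⟩ : ∃ m, k - (A.drop a).length = m + 1 := ⟨_, (Nat.succ_pred_eq_of_pos this).symm⟩
  rw [hm]; simp

theorem mem_drop_app (A B : List V) (t : V) (a : ℕ) (h1 : a ≤ A.length) :
    t ∈ (A ++ t :: B).drop a := by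
  rw [List.drop_append_of_le_length h1]; simp

theorem mem_take_app (A B : List V) (t : V) (k : ℕ) (h2 : A.length < k) :
    t ∈ (A ++ t :: B).take k := by
  have := mem_drop_take A B t 0 k (by omega) (by omega)
  simpa using this

theorem exists_max_nat {α : Type*} (P : α → Prop) (f : α → ℕ) (N : ℕ) (hP : ∃ a, P a)
    (hN : ∀ a, P a → f a ≤ N) : ∃ a, P a ∧ ∀ b, P b → f b ≤ f a := by
  obtain ⟨a0, h0⟩ := hP
  obtain ⟨a, ha, hm⟩ := WellFounded.has_min (measure (fun a => N - f a)).wf {a | P a} ⟨a0, h0⟩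
  refine ⟨a, ha, fun b hb => ?_⟩
  have h1 := hm b hb
  have h2 := hN b hb
  have h3 := hN a ha
  change ¬ (N - f b < N - f a) at h1
  omega

/-- the conclusion of the theorem -/
def Boom (D : V → V → Prop) (k₁ k₂ : ℕ) : Prop :=
  ∃ (x y : V) (p q : List V), x ≠ y ∧
      IsDipathList D p ∧ p.head? = some x ∧ p.getLast? = some y ∧ k₁ + 1 ≤ p.length ∧
      IsDipathList D q ∧ q.head? = some x ∧ q.getLast? = some y ∧ k₂ + 1 ≤ q.length ∧
      (∀ z ∈ p, z ∈ q → z = x ∨ z = y)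

theorem boom_mk (D : V → V → Prop) (k₁ k₂ : ℕ) (x y : V) (I J : List V)
    (hI : List.IsChain D (x :: I ++ [y])) (hJ : List.IsChain D (x :: J ++ [y]))
    (nI : (x :: I ++ [y]).Nodup) (nJ : (x :: J ++ [y]).Nodup)
    (dis : ∀ a ∈ I, a ∉ J) (h1 : k₁ ≤ I.length + 1) (h2 : k₂ ≤ J.length + 1) :
    Boom D k₁ k₂ := by
  refine ⟨x, y, x :: I ++ [y], x :: J ++ [y], ?_, ⟨by simp, nI, hI⟩, by simp, List.getLast?_concat,
    by simp; omega, ⟨by simp, nJ, hJ⟩, by simp, List.getLast?_concat, by simp; omega, ?_⟩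
  · rintro rfl; simp at nI
  · intro z hz hz'
    simp only [List.cons_append, List.mem_cons, List.mem_append, List.not_mem_nil, or_false] at hz hz'
    have := dis z
    tauto

/-- directed cycle as a list -/
def Cyc (D : V → V → Prop) (C : List V) : Prop :=
  ∃ z M, C = z :: M ∧ C.Nodup ∧ List.IsChain D (z :: M ++ [z])

theorem Cyc.nodup {D : V → V → Prop} {C : List V} (h : Cyc D C) : C.Nodup := by
  obtain ⟨z, M, rfl, h, _⟩ := h; exact h

theorem Cyc.chain {D : V → V → Prop} {z : V} {M : List V} (h : Cyc D (z :: M)) :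
    List.IsChain D (z :: M ++ [z]) := by
  obtain ⟨z', M', e, _, h⟩ := h
  obtain ⟨rfl, rfl⟩ := List.cons.inj e
  exact h

theorem cyc_mk {D : V → V → Prop} {z : V} {M : List V} (hn : (z :: M).Nodup)
    (h : List.IsChain D (z :: M ++ [z])) : Cyc D (z :: M) := ⟨z, M, rfl, hn, h⟩

theorem cyc_rot {D : V → V → Prop} {A B : List V} {z : V} (h : Cyc D (A ++ z :: B)) :
    Cyc D (z :: B ++ A) := by
  cases A with
  | nil => simpa using h
  | cons a A =>
    have hc : List.IsChain D (a :: (A ++ z :: B) ++ [a]) := h.chain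
    have hn := h.nodup
    change Cyc D (z :: (B ++ a :: A))
    refine cyc_mk ?_ ?_
    · have : ((z :: B) ++ (a :: A)).Nodup := by
        rw [List.nodup_append_comm]; simpa using hn
      simpa using this
    · have e1 : a :: (A ++ z :: B) ++ [a] = (a :: A) ++ z :: (B ++ [a]) := by simp
      rw [e1, List.isChain_split] at hc
      have e2 : z :: (B ++ a :: A) ++ [z] = (z :: B) ++ a :: (A ++ [z]) := by simp
      have : List.IsChain D (z :: (B ++ a :: A) ++ [z]) := by
        rw [e2, List.isChain_split]
        exact ⟨by simpa using hc.2, by simpa using hc.1⟩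
      simpa using this

theorem cyc_rot_mem {D : V → V → Prop} {C : List V} {z : V} (h : Cyc D C) (hz : z ∈ C) :
    ∃ M, Cyc D (z :: M) ∧ (z :: M).Perm C := by
  obtain ⟨A, B, rfl⟩ := List.append_of_mem hz
  exact ⟨B ++ A, cyc_rot h, by simpa using (List.perm_append_comm (l₁ := z :: B) (l₂ := A))⟩

/-- lollipop -/
structure Lol (D : V → V → Prop) (k₁ : ℕ) (U : List V) (g : V) (C : List V) : Prop where
  cyc : Cyc D C
  gm : g ∈ C
  ch : List.IsChain D (U ++ [g])
  nd : U.Nodup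
  dj : ∀ x ∈ U, x ∉ C
  len : k₁ + 1 ≤ C.length

def wall (U : List V) (k₂ : ℕ) : List V := U.drop (U.length - (k₂ - 2))
def far (U : List V) (k₂ : ℕ) : List V := U.take (U.length - (k₂ - 2))

inductive Rch (D : V → V → Prop) (F : List V) (X : Set V) : V → Prop
  | base (v : V) (h : v ∈ F) : Rch D F X v
  | step (v w : V) (h : v ∉ X) (hd : D v w) (hr : Rch D F X w) : Rch D F X v

def YY (D : V → V → Prop) (k₂ : ℕ) (U C : List V) : Set V :=
  {v | Rch D (far U k₂) {x | x ∈ C ∨ x ∈ wall U k₂} v}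

def ZZ (D : V → V → Prop) (k₂ : ℕ) (U C : List V) : Set V :=
  {v | v ∉ C ∧ v ∉ wall U k₂ ∧ v ∉ YY D k₂ U C}

theorem YY_perm (D : V → V → Prop) (k₂ : ℕ) (U : List V) {C C' : List V} (h : C'.Perm C) :
    YY D k₂ U C' = YY D k₂ U C := by
  unfold YY
  have : {x | x ∈ C' ∨ x ∈ wall U k₂} = {x | x ∈ C ∨ x ∈ wall U k₂} := by
    ext x; simp [h.mem_iff]
  rw [this]

theorem ZZ_perm (D : V → V → Prop) (k₂ : ℕ) (U : List V) {C C' : List V} (h : C'.Perm C) :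
    ZZ D k₂ U C' = ZZ D k₂ U C := by
  unfold ZZ
  rw [YY_perm D k₂ U h]
  ext x; simp [h.mem_iff]

theorem mem_U_iff (U : List V) (k₂ : ℕ) (x : V) : x ∈ U ↔ x ∈ far U k₂ ∨ x ∈ wall U k₂ := by
  unfold far wall
  rw [← List.mem_append, List.take_append_drop]

theorem wall_length (U : List V) (k₂ : ℕ) : (wall U k₂).length ≤ k₂ - 2 := by
  unfold wall; simp; omega

theorem ZZ_not_U {D : V → V → Prop} {k₂ : ℕ} {U C : List V} {x : V} (h : x ∈ ZZ D k₂ U C) :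
    x ∉ U := by
  intro hx
  rcases (mem_U_iff U k₂ x).1 hx with h' | h'
  · exact h.2.2 (Rch.base x h')
  · exact h.2.1 h'

theorem ZZ_nbr {D : V → V → Prop} {k₂ : ℕ} {U C : List V} {x w : V} (h : x ∈ ZZ D k₂ U C)
    (hd : D x w) : w ∉ YY D k₂ U C := by
  intro hw
  apply h.2.2
  refine Rch.step x w ?_ hd hw
  rintro (h' | h')
  · exact h.1 h'
  · exact h.2.1 h'

theorem cases_nbr {D : V → V → Prop} {k₂ : ℕ} {U C : List V} {w : V} (h : w ∉ YY D k₂ U C) :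
    w ∈ wall U k₂ ∨ w ∈ C ∨ w ∈ ZZ D k₂ U C := by
  by_cases h1 : w ∈ wall U k₂
  · exact Or.inl h1
  by_cases h2 : w ∈ C
  · exact Or.inr (Or.inl h2)
  exact Or.inr (Or.inr ⟨h2, h1, h⟩)

theorem Rch_path {D : V → V → Prop} {F : List V} {X : Set V} {w : V} (h : Rch D F X w) :
    ∃ l u, u ∈ F ∧ List.IsChain D (l ++ [u]) ∧ (l ++ [u]).head? = some w ∧ l.Nodup ∧
      ∀ x ∈ l, x ∉ X ∧ x ∉ F := by
  induction h with
  | base v h => exact ⟨[], v, h, by simp, by simp, by simp, by simp⟩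
  | step v w hX hd hr ih =>
    obtain ⟨l, u, hu, hc, hh, hn, hl⟩ := ih
    by_cases hF : v ∈ F
    · exact ⟨[], v, hF, by simp, by simp, by simp, by simp⟩
    by_cases hv : v ∈ l
    · obtain ⟨A, B, rfl⟩ := List.append_of_mem hv
      refine ⟨v :: B, u, hu, ?_, by simp, ?_, ?_⟩
      · rw [List.append_assoc, List.cons_append, List.isChain_split] at hc
        simpa using hc.2
      · exact (List.nodup_append.1 hn).2.1
      · intro x hx; exact hl x (List.mem_append_right _ hx)
    · refine ⟨v :: l, u, hu, ?_, by simp, ?_, ?_⟩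
      · rw [List.cons_append, List.isChain_cons]
        refine ⟨?_, hc⟩
        intro y hy
        rw [hh] at hy
        simp at hy
        exact hy ▸ hd
      · exact List.nodup_cons.2 ⟨hv, hn⟩
      · intro x hx
        rcases List.mem_cons.1 hx with rfl | hx
        · exact ⟨hX, hF⟩
        · exact hl x hx

/-- maximal lollipop in a counterexample -/
structure Good (D : V → V → Prop) (k₁ k₂ : ℕ) (U : List V) (g : V) (C : List V) : Prop where
  lol : Lol D k₁ U g C
  loop : ∀ v, ¬ D v v
  maxU : ∀ U' g' C', Lol D k₁ U' g' C' → U'.length ≤ U.length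
  maxY : ∀ C', Lol D k₁ U g C' → (YY D k₂ U C').ncard ≤ (YY D k₂ U C).ncard ∧
    ((YY D k₂ U C').ncard = (YY D k₂ U C).ncard → C'.length ≤ C.length)
  nb : ¬ Boom D k₁ k₂
  hk₂ : 2 ≤ k₂
  hk : k₂ ≤ k₁
  deg : ∀ v, k₁ + 3 * k₂ - 5 ≤ outDeg D v

theorem Good.rot {D : V → V → Prop} {k₁ k₂ : ℕ} {U : List V} {g : V} {C C' : List V}
    (h : Good D k₁ k₂ U g C) (hc : Cyc D C') (hp : C'.Perm C) : Good D k₁ k₂ U g C' := by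
  refine ⟨⟨hc, hp.mem_iff.2 h.lol.gm, h.lol.ch, h.lol.nd, ?_, ?_⟩, h.loop, h.maxU, ?_, h.nb, h.hk₂,
    h.hk, h.deg⟩
  · intro x hx hx'
    exact h.lol.dj x hx (hp.mem_iff.1 hx')
  · rw [hp.length_eq]; exact h.lol.len
  · intro C'' h''
    rw [YY_perm D k₂ U hp, hp.length_eq]
    exact h.maxY C'' h''

theorem C_not_YY {D : V → V → Prop} {k₁ k₂ : ℕ} {U : List V} {g : V} {C : List V}
    (h : Lol D k₁ U g C) {x : V} (hx : x ∈ C) : x ∉ YY D k₂ U C := by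
  intro hy
  cases hy with
  | base _ hF => exact h.dj x ((mem_U_iff U k₂ x).2 (Or.inl hF)) hx
  | step _ w hX _ _ => exact hX (Or.inl hx)

/-- maximal tails -/
theorem max_tail [Fintype V] (D : V → V → Prop) (A : Set V) (c : V) (Q₀ : List V)
    (h0 : List.IsChain D (c :: Q₀)) (hn0 : Q₀.Nodup) (hA0 : ∀ x ∈ Q₀, x ∈ A) :
    ∃ Q b P, c :: Q = P ++ [b] ∧ List.IsChain D (c :: Q) ∧ Q.Nodup ∧ (∀ x ∈ Q, x ∈ A) ∧
      Q₀.length ≤ Q.length ∧ ∀ w ∈ A, D b w → w ∈ Q := by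
  classical
  obtain ⟨Q, ⟨hc, hn, hA⟩, hm⟩ := exists_max_nat
    (fun Q : List V => List.IsChain D (c :: Q) ∧ Q.Nodup ∧ (∀ x ∈ Q, x ∈ A)) List.length
    (Fintype.card V) ⟨Q₀, h0, hn0, hA0⟩ (fun Q hQ => hQ.2.1.length_le_card)
  refine ⟨Q, (c :: Q).getLast (by simp), (c :: Q).dropLast,
    (List.dropLast_append_getLast _).symm, hc, hn, hA, hm Q₀ ⟨h0, hn0, hA0⟩, ?_⟩
  intro w hw hd
  by_contra hwQ
  have := hm (Q ++ [w]) ⟨?_, ?_, ?_⟩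
  · simp at this
  · rw [← List.cons_append, List.isChain_append]
    refine ⟨hc, by simp, ?_⟩
    intro x hx y hy
    rw [List.getLast?_eq_some_getLast (by simp)] at hx
    simp at hx hy
    subst hx hy
    simpa using hd
  · rw [List.nodup_append]
    refine ⟨hn, by simp, ?_⟩
    intro a ha b hb
    simp at hb
    subst hb
    rintro rfl
    exact hwQ ha
  · intro x hx
    rcases List.mem_append.1 hx with hx | hx
    · exact hA x hx
    · simp at hx; exact hx ▸ hw


theorem chain_glue {D : V → V → Prop} {A B : List V} {c : V} (h1 : List.IsChain D (A ++ [c]))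
    (h2 : List.IsChain D (c :: B)) : List.IsChain D (A ++ c :: B) :=
  List.isChain_split.2 ⟨h1, h2⟩

theorem chain_snoc {D : V → V → Prop} {P : List V} {b w : V} (h1 : List.IsChain D (P ++ [b]))
    (h2 : D b w) : List.IsChain D (P ++ [b] ++ [w]) := by
  rw [List.append_assoc]
  exact chain_glue h1 (by simpa using h2)

theorem ear_op [Fintype V] {D : V → V → Prop} {k₁ k₂ : ℕ} {U : List V} {g : V} {z t : V}
    {M B Q : List V} (h : Good D k₁ k₂ U g (z :: M ++ t :: B))
    (hc : List.IsChain D (z :: Q ++ [t])) (hn : Q.Nodup)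
    (hQ : ∀ x ∈ Q, x ∈ ZZ D k₂ U (z :: M ++ t :: B)) (hlen : k₁ ≤ Q.length + B.length + 1) :
    g ∉ M ∧ YY D k₂ U (z :: Q ++ t :: B) = YY D k₂ U (z :: M ++ t :: B) ∧
      Q.length ≤ M.length := by
  have hcy := h.lol.cyc
  have hnd := hcy.nodup
  have hch : List.IsChain D ((z :: M) ++ t :: (B ++ [z])) := by
    have := hcy.chain (z := z) (M := M ++ t :: B)
    simpa using this
  have hQC : ∀ x ∈ Q, x ∉ z :: M ++ t :: B := fun x hx => (hQ x hx).1
  have hQU : ∀ x ∈ Q, x ∉ U := fun x hx => ZZ_not_U (hQ x hx)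
  have hdj := h.lol.dj
  have hUn := h.lol.nd
  have hcyc' : Cyc D (z :: (Q ++ t :: B)) := by
    refine cyc_mk ?_ ?_
    · simp only [List.cons_append, List.nodup_cons, List.nodup_append, List.mem_append,
        List.mem_cons] at hnd hQC ⊢
      grind
    · have := chain_glue hc (List.isChain_split.1 hch).2
      simpa using this
  have hlen' : k₁ + 1 ≤ (z :: (Q ++ t :: B)).length := by simp; omega
  have hgM : g ∉ M := by
    intro hg
    obtain ⟨M1, M2, rfl⟩ := List.append_of_mem hg
    have hl : Lol D k₁ (U ++ g :: M2) t (z :: (Q ++ t :: B)) := by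
      refine ⟨hcyc', by simp, ?_, ?_, ?_, hlen'⟩
      · have h1 : List.IsChain D ((z :: M1) ++ g :: (M2 ++ [t])) := by
          simpa using (List.isChain_split.1 hch).1
        have := chain_glue h.lol.ch (List.isChain_split.1 h1).2
        simpa using this
      · simp only [List.cons_append, List.nodup_cons, List.nodup_append, List.mem_append,
          List.mem_cons] at hnd hQC hdj hUn ⊢
        grind
      · simp only [List.cons_append, List.nodup_cons, List.nodup_append, List.mem_append,
          List.mem_cons] at hnd hQC hdj hUn ⊢
        grind
    have := h.maxU _ _ _ hl
    simp at this
  have hgC := h.lol.gm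
  have hl : Lol D k₁ U g (z :: (Q ++ t :: B)) := by
    refine ⟨hcyc', ?_, h.lol.ch, h.lol.nd, ?_, hlen'⟩
    · simp only [List.cons_append, List.mem_append, List.mem_cons] at hgC ⊢
      tauto
    · intro x hx hx'
      have := hdj x hx
      have := hQU x
      simp only [List.cons_append, List.mem_append, List.mem_cons] at *
      tauto
  have hsub : YY D k₂ U (z :: M ++ t :: B) ⊆ YY D k₂ U (z :: Q ++ t :: B) := by
    intro v hv
    induction hv with
    | base v hF => exact Rch.base v hF
    | step v w hX hd hr ih =>
      refine Rch.step v w ?_ hd ih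
      intro hv
      have h1 : v ∈ YY D k₂ U (z :: M ++ t :: B) := Rch.step v w hX hd hr
      have h2 : v ∉ Q := fun hvQ => (hQ v hvQ).2.2 h1
      simp only [Set.mem_setOf_eq, List.cons_append, List.mem_append, List.mem_cons] at hX hv
      tauto
  obtain ⟨m1, m2⟩ := h.maxY _ hl
  have heq : YY D k₂ U (z :: M ++ t :: B) = YY D k₂ U (z :: Q ++ t :: B) :=
    Set.eq_of_subset_of_ncard_le hsub m1 (Set.toFinite _)
  refine ⟨hgM, heq.symm, ?_⟩
  have := m2 (congrArg Set.ncard heq.symm)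
  simp at this
  omega

theorem back_op {D : V → V → Prop} {k₁ k₂ : ℕ} {U : List V} {g : V} {z q : V}
    {M Q P1 P2 : List V} (h : Good D k₁ k₂ U g (z :: M)) (hzg : z ≠ g)
    (hn : Q.Nodup) (hQ : ∀ x ∈ Q, x ∈ ZZ D k₂ U (z :: M))
    (hP : z :: Q = P1 ++ q :: P2) (hc : List.IsChain D (P1 ++ q :: P2 ++ [q])) :
    P2.length + 1 ≤ k₁ := by
  by_contra hlen
  have hcy := h.lol.cyc
  have hnd := hcy.nodup
  have hQC : ∀ x ∈ Q, x ∉ z :: M := fun x hx => (hQ x hx).1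
  have hQU : ∀ x ∈ Q, x ∉ U := fun x hx => ZZ_not_U (hQ x hx)
  have hdj := h.lol.dj
  have hUn := h.lol.nd
  have hgM : g ∈ M := by
    have := h.lol.gm
    rcases List.mem_cons.1 this with h | h
    · exact absurd h.symm hzg
    · exact h
  obtain ⟨B1, M1, rfl⟩ := List.append_of_mem hgM
  have hch : List.IsChain D ((z :: B1) ++ g :: (M1 ++ [z])) := by
    simpa using hcy.chain
  have hch2 := (List.isChain_split.1 hch).2
  have hPn : (P1 ++ q :: P2).Nodup := by
    rw [← hP, List.nodup_cons]
    exact ⟨fun hz => hQC z hz (by simp), hn⟩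
  have hPm : ∀ x ∈ P1 ++ q :: P2, x ∉ U ∧ x ≠ g ∧ x ∉ M1 := by
    intro x hx
    rw [← hP] at hx
    simp only [List.nodup_cons, List.nodup_append, List.mem_append, List.mem_cons] at hnd hQC hdj hx
    grind
  have hc1 : List.IsChain D (P1 ++ q :: (P2 ++ [q])) := by simpa using hc
  have hc2 := List.isChain_split.1 hc1
  have hl : Lol D k₁ (U ++ g :: M1 ++ P1) q (q :: P2) := by
    refine ⟨cyc_mk (List.nodup_append.1 hPn).2.1 (by simpa using hc2.2), by simp, ?_, ?_, ?_, ?_⟩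
    · have e : ∃ R, P1 ++ [q] = z :: R := by
        cases P1 with
        | nil => simp at hP; exact ⟨[], by simp [hP.1]⟩
        | cons a P => simp at hP; exact ⟨P ++ [q], by simp [hP.1]⟩
      obtain ⟨R, hR⟩ := e
      have h3 := hc2.1
      rw [List.append_assoc, hR]
      rw [hR] at h3
      apply chain_glue _ h3
      have := chain_glue h.lol.ch hch2
      simpa using this
    · simp only [List.nodup_cons, List.nodup_append, List.mem_append, List.mem_cons]
        at hnd hPm hdj hUn hPn ⊢
      grind
    · simp only [List.nodup_cons, List.nodup_append, List.mem_append, List.mem_cons]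
        at hnd hPm hdj hUn hPn ⊢
      grind
    · simp; omega
  have := h.maxU _ _ _ hl
  simp at this

theorem claim1 {D : V → V → Prop} {k₁ k₂ : ℕ} {U : List V} {g f w : V} {M B : List V}
    (h : Good D k₁ k₂ U g (f :: M ++ g :: B)) (hM : k₁ ≤ M.length + 1) (hd : D f w) :
    w ∉ YY D k₂ U (f :: M ++ g :: B) := by
  intro hw
  obtain ⟨l, u, hu, hc, hh, hn, hl⟩ := Rch_path hw
  have hcy := h.lol.cyc
  have hnd := hcy.nodup
  have hdj := h.lol.dj
  have hUn := h.lol.nd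
  have hk₂ := h.hk₂
  have hch : List.IsChain D ((f :: M) ++ g :: (B ++ [f])) := by
    have := hcy.chain (z := f) (M := M ++ g :: B)
    simpa using this
  have hlU : ∀ x ∈ l, x ∉ U := by
    intro x hx hxU
    rcases (mem_U_iff U k₂ x).1 hxU with h' | h'
    · exact (hl x hx).2 h'
    · exact (hl x hx).1 (Or.inr h')
  have hlC : ∀ x ∈ l, x ∉ f :: M ++ g :: B := fun x hx hxC => (hl x hx).1 (Or.inl hxC)
  obtain ⟨A, A', hA⟩ := List.append_of_mem hu
  have hU : U = A ++ u :: (A' ++ wall U k₂) := by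
    have := List.take_append_drop (U.length - (k₂ - 2)) U
    change far U k₂ ++ wall U k₂ = U at this
    rw [hA] at this
    simpa using this.symm
  have hwl : k₂ - 2 ≤ (A' ++ wall U k₂).length := by
    have hne : (far U k₂).length = U.length - (k₂ - 2) := by simp [far]
    have : 0 < (far U k₂).length := by rw [hA]; simp
    have h2 : (wall U k₂).length = U.length - (U.length - (k₂ - 2)) := by simp [wall]
    simp; omega
  generalize A' ++ wall U k₂ = U2 at hU hwl
  have hUch := h.lol.ch
  rw [hU, List.append_assoc, List.cons_append, List.isChain_split] at hUch
  have hJ : List.IsChain D (f :: (l ++ u :: U2) ++ [g]) := by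
    have h1 : List.IsChain D (l ++ u :: (U2 ++ [g])) := chain_glue hc hUch.2
    have h2 : List.IsChain D (f :: (l ++ u :: (U2 ++ [g]))) := by
      rw [List.isChain_cons]
      refine ⟨?_, h1⟩
      intro y hy
      have : (l ++ u :: (U2 ++ [g])).head? = (l ++ [u]).head? := by
        cases l <;> simp
      rw [this, hh] at hy
      simp at hy
      exact hy ▸ hd
    simpa using h2
  apply h.nb
  have hu : ∀ x ∈ u :: U2, x ∈ U := by
    intro x hx; rw [hU]; exact List.mem_append_right _ hx
  have hn2 : (u :: U2).Nodup := by
    rw [hU] at hUn; exact (List.nodup_append.1 hUn).2.1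
  clear hU
  apply boom_mk D k₁ k₂ f g M (l ++ u :: U2) ?_ hJ ?_ ?_ ?_ hM ?_
  · exact (List.isChain_split.1 hch).1
  · simp only [List.cons_append, List.nodup_cons, List.nodup_append, List.mem_append, List.mem_cons,
      List.not_mem_nil] at hnd ⊢
    grind
  · simp only [List.cons_append, List.nodup_cons, List.nodup_append, List.mem_append, List.mem_cons,
      List.not_mem_nil] at hnd hlC hdj hn hlU hu hn2 ⊢
    grind
  · simp only [List.cons_append, List.nodup_cons, List.nodup_append, List.mem_append, List.mem_cons,
      List.not_mem_nil] at hnd hlC hdj hn hlU hu ⊢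
    grind
  · simp; omega


theorem mem_front {c b w : V} {Q P : List V} (h : c :: Q = P ++ [b]) (hw : w ∈ c :: Q)
    (hb : w ≠ b) : w ∈ P := by
  rw [h] at hw
  simpa [hb] using hw

theorem claim2_aux [Fintype V] {D : V → V → Prop} {k₁ k₂ : ℕ} {U : List V} {g c : V}
    {M Q₀ : List V} (h : Good D k₁ k₂ U g (c :: M)) (hcg : c ≠ g)
    (hc0 : List.IsChain D (c :: Q₀)) (hn0 : Q₀.Nodup)
    (hQ0 : ∀ x ∈ Q₀, x ∈ ZZ D k₂ U (c :: M)) : Q₀.length ≤ k₂ - 2 := by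
  by_contra hlen
  obtain ⟨Q, b, P, hP, hc, hn, hQ, hge, hmax⟩ := max_tail D _ c Q₀ hc0 hn0 hQ0
  have hk₂ := h.hk₂
  have hk := h.hk
  have hnd := h.lol.cyc.nodup
  have hch := h.lol.cyc.chain
  have hPl : P.length = Q.length := by
    have := congrArg List.length hP
    simp at this; omega
  have hbQ : b ∈ Q := by
    cases P with
    | nil => simp at hPl; omega
    | cons a P => simp at hP; rw [hP.2]; simp
  have hQC : ∀ x ∈ Q, x ∉ c :: M := fun x hx => (hQ x hx).1
  have hsn : ∀ w, D b w → List.IsChain D (c :: Q ++ [w]) := by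
    intro w hd
    rw [hP] at hc ⊢
    exact chain_snoc hc hd
  have key := outDeg_le_length D b (wall U k₂ ++ P.drop (Q.length - (k₁ - 1)) ++
    (M.drop Q.length).take (k₁ - 1 - Q.length)) ?_
  · have h1 := h.deg b
    have h2 := wall_length U k₂
    simp only [List.length_append, List.length_drop, List.length_take] at key
    omega
  intro w hd
  have hwb : w ≠ b := fun e => h.loop b (e ▸ hd)
  have hinP : w ∈ P → w ∈ P.drop (Q.length - (k₁ - 1)) := by
    intro hw
    obtain ⟨P1, P2, rfl⟩ := List.append_of_mem hw
    have := back_op (P1 := P1) (q := w) (P2 := P2 ++ [b]) h hcg hn hQ (by simpa using hP) (by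
      have := hsn w hd
      rw [hP] at this
      simpa using this)
    apply mem_drop_app
    simp at this hPl
    omega
  rcases cases_nbr (ZZ_nbr (hQ b hbQ) hd) with hw | hw | hw
  · simp [hw]
  · rcases List.mem_cons.1 hw with rfl | hwM
    · have := hinP (mem_front hP (by simp) hwb)
      simp [this]
    · obtain ⟨M1, B, rfl⟩ := List.append_of_mem hwM
      have h1 : M1.length + 1 < k₁ := by
        by_contra hcon
        apply h.nb
        apply boom_mk D k₁ k₂ c w M1 Q ?_ (hsn w hd) ?_ ?_ ?_ (by omega) (by omega)
        · have : List.IsChain D ((c :: M1) ++ w :: (B ++ [c])) := by simpa using hch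
          exact (List.isChain_split.1 this).1
        · simp only [List.cons_append, List.nodup_cons, List.nodup_append, List.mem_append,
            List.mem_cons, List.not_mem_nil] at hnd ⊢
          grind
        · simp only [List.cons_append, List.nodup_cons, List.nodup_append, List.mem_append,
            List.mem_cons, List.not_mem_nil] at hnd hQC ⊢
          grind
        · intro a ha ha'
          exact hQC a ha' (by simp [ha])
      have hl := h.lol.len
      have h2 : Q.length ≤ M1.length := by
        by_contra hcon
        have := (ear_op (M := M1) (t := w) (B := B) h (hsn w hd) hn hQ
          (by simp at hl; omega)).2.2
        omega
      have := mem_drop_take M1 B w Q.length (k₁ - 1 - Q.length) h2 (by omega)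
      simp only [List.mem_append]
      exact Or.inr this
  · have := hinP (mem_front hP (List.mem_cons_of_mem _ (hmax w hw hd)) hwb)
    simp [this]

def Ear (D : V → V → Prop) (k₁ k₂ : ℕ) (U C : List V) (j : ℕ) : Prop :=
  ∃ z M Q t B, Cyc D (z :: M ++ t :: B) ∧ (z :: M ++ t :: B).Perm C ∧
    List.IsChain D (z :: Q ++ [t]) ∧ Q.Nodup ∧ (∀ x ∈ Q, x ∈ ZZ D k₂ U C) ∧
    M.length + 1 = j ∧ k₂ ≤ j ∧ k₁ ≤ B.length + 1

theorem claim3 [Fintype V] {D : V → V → Prop} {k₁ k₂ : ℕ} {U : List V} {g : V} {C : List V}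
    (h0 : Good D k₁ k₂ U g C) : ∃ j, Ear D k₁ k₂ U C j := by
  by_contra hno
  obtain ⟨M', hcy', hp'⟩ := cyc_rot_mem h0.lol.cyc h0.lol.gm
  have hk₂ := h0.hk₂
  have hk := h0.hk
  have hlen := h0.lol.len
  cases M' with
  | nil => have := hp'.length_eq; simp at this; omega
  | cons z R =>
    have hcy : Cyc D (z :: (R ++ [g])) := cyc_rot (A := [g]) hcy'
    have hp : (z :: (R ++ [g])).Perm C :=
      (List.perm_append_comm (l₁ := z :: R) (l₂ := [g])).trans hp'
    have h := h0.rot hcy hp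
    have hno' : ¬ ∃ j, Ear D k₁ k₂ U (z :: (R ++ [g])) j := by
      rintro ⟨j, a, b, c, d, e, e1, e2, e3, e4, e5, e6⟩
      exact hno ⟨j, a, b, c, d, e, e1, e2.trans hp, e3, e4, by rwa [← ZZ_perm D k₂ U hp], e6⟩
    rw [← hp.length_eq] at hlen
    have hzg : z ≠ g := by
      rintro rfl
      have := h.lol.cyc.nodup
      simp at this
    have hne : ∀ w, D z w → w ∉ YY D k₂ U (z :: (R ++ [g])) := by
      intro w hd
      exact claim1 (M := R) (B := []) h (by simp at hlen; omega) hd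
    generalize R ++ [g] = M at *
    obtain ⟨Q, b, P, hP, hc, hn, hQ, -, hmax⟩ := max_tail D (ZZ D k₂ U (z :: M)) z []
      (by simp) (by simp) (by simp)
    have hs := claim2_aux h hzg hc hn hQ
    have hPl : P.length = Q.length := by
      have := congrArg List.length hP
      simp at this; omega
    have hbn : ∀ w, D b w → w ∉ YY D k₂ U (z :: M) := by
      intro w hd
      have : b ∈ z :: Q := by rw [hP]; simp
      rcases List.mem_cons.1 this with rfl | hb
      · exact hne w hd
      · exact ZZ_nbr (hQ b hb) hd
    have key := outDeg_le_length D b (wall U k₂ ++ P ++ M.take (k₂ - 1) ++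
      M.drop (M.length - (k₁ - 1))) ?_
    · have h1 := h.deg b
      have h2 := wall_length U k₂
      simp only [List.length_append, List.length_drop, List.length_take] at key
      omega
    intro w hd
    have hwb : w ≠ b := fun e => h.loop b (e ▸ hd)
    rcases cases_nbr (hbn w hd) with hw | hw | hw
    · simp [hw]
    · rcases List.mem_cons.1 hw with rfl | hwM
      · have := mem_front hP (by simp) hwb
        simp [this]
      · obtain ⟨M1, B, rfl⟩ := List.append_of_mem hwM
        by_cases h1 : M1.length + 1 < k₂
        · have := mem_take_app M1 B w (k₂ - 1) (by omega)
          simp only [List.mem_append]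
          exact Or.inl (Or.inr this)
        by_cases h2 : B.length + 1 < k₁
        · have := mem_drop_app M1 B w ((M1 ++ w :: B).length - (k₁ - 1)) (by simp; omega)
          simp only [List.mem_append] at this ⊢
          exact Or.inr this
        · exfalso
          apply hno'
          refine ⟨_, z, M1, Q, w, B, hcy, List.Perm.refl _, ?_, hn, hQ, rfl, by omega, by omega⟩
          rw [hP] at hc ⊢
          exact chain_snoc hc hd
    · have := mem_front hP (List.mem_cons_of_mem _ (hmax w hw hd)) hwb
      simp [this]

theorem claim5 [Fintype V] {D : V → V → Prop} {k₁ k₂ : ℕ} {U : List V} {g : V} {C : List V}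
    (h0 : Good D k₁ k₂ U g C) : False := by
  classical
  have hex := claim3 h0
  obtain ⟨z', M, E, t', B, hcy, hp, hEc, hEn, hEZ, hj, hjk, hB⟩ := Nat.find_spec hex
  have hmin : ∀ j, Ear D k₁ k₂ U C j → M.length + 1 ≤ j := by
    intro j hjE
    rw [hj]
    exact Nat.find_min' hex hjE
  rw [← hj] at hjk
  clear hj
  have hk₂ := h0.hk₂
  have hk := h0.hk
  have h1 := h0.rot hcy hp
  rw [← ZZ_perm D k₂ U hp] at hEZ
  obtain ⟨hgM, hYeq, -⟩ := ear_op h1 hEc hEn hEZ (by omega)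
  have hEC : ∀ x ∈ E, x ∉ z' :: M ++ t' :: B := fun x hx => (hEZ x hx).1
  have hcyn := hcy.nodup
  have hne0 : ∀ x ∈ M, ∀ w, D x w → w ∉ YY D k₂ U (z' :: M ++ t' :: B) := by
    intro x hx w hd hw
    have hxC : x ∈ z' :: M ++ t' :: B := by simp [hx]
    apply C_not_YY h1.lol hxC (k₂ := k₂)
    rw [← hYeq] at hw ⊢
    refine Rch.step x w ?_ hd hw
    rintro (h' | h')
    · have := hEC x
      simp only [List.cons_append, List.nodup_cons, List.nodup_append, List.mem_append,
        List.mem_cons] at hcyn h' this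
      grind
    · exact h1.lol.dj x ((mem_U_iff U k₂ x).2 (Or.inr h')) hxC
  obtain ⟨M1, z, M2, rfl, hM1⟩ : ∃ M1 z M2, M = M1 ++ z :: M2 ∧ M1.length = k₂ - 2 := by
    have hl : k₂ - 2 < M.length := by omega
    refine ⟨M.take (k₂ - 2), M[k₂ - 2], M.drop (k₂ - 2 + 1), ?_, by simp; omega⟩
    rw [← List.drop_eq_getElem_cons hl, List.take_append_drop]
  have hzg : z ≠ g := by rintro rfl; exact hgM (by simp)
  have hcy2 : Cyc D (z :: (M2 ++ t' :: B ++ z' :: M1)) := by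
    have : Cyc D ((z' :: M1) ++ z :: (M2 ++ t' :: B)) := by simpa using hcy
    simpa using cyc_rot this
  have hp2 : (z :: (M2 ++ t' :: B ++ z' :: M1)).Perm (z' :: (M1 ++ z :: M2) ++ t' :: B) := by
    have := List.perm_append_comm (l₁ := z :: (M2 ++ t' :: B)) (l₂ := z' :: M1)
    simpa using this
  have h2 := h1.rot hcy2 hp2
  have hne := hne0 z (by simp)
  rw [← YY_perm D k₂ U hp2] at hne
  rw [← ZZ_perm D k₂ U hp2] at hEZ
  have hnd := hcy2.nodup
  have hEC2 : ∀ x ∈ E, x ∉ z :: (M2 ++ t' :: B ++ z' :: M1) := fun x hx => (hEZ x hx).1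
  have hch1 : List.IsChain D ((z' :: M1) ++ z :: (M2 ++ t' :: B ++ [z'])) := by
    have := hcy.chain (z := z') (M := M1 ++ z :: M2 ++ t' :: B)
    simpa using this
  have hch2 : List.IsChain D ((z' :: M1 ++ z :: M2) ++ t' :: (B ++ [z'])) := by
    simpa using hch1
  clear hne0 hYeq hgM
  obtain ⟨Q, b, P, hP, hc, hn, hQA, -, hmax⟩ := max_tail D
    {x | x ∈ ZZ D k₂ U (z :: (M2 ++ t' :: B ++ z' :: M1)) ∧ x ∉ E} z []
      (by simp) (by simp) (by simp)
  have hQ : ∀ x ∈ Q, x ∈ ZZ D k₂ U (z :: (M2 ++ t' :: B ++ z' :: M1)) := fun x hx => (hQA x hx).1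
  have hQE : ∀ x ∈ Q, x ∉ E := fun x hx => (hQA x hx).2
  have hQC : ∀ x ∈ Q, x ∉ z :: (M2 ++ t' :: B ++ z' :: M1) := fun x hx => (hQ x hx).1
  have hs := claim2_aux h2 hzg hc hn hQ
  have hPl : P.length = Q.length := by
    have := congrArg List.length hP
    simp at this; omega
  have hbn : ∀ w, D b w → w ∉ YY D k₂ U (z :: (M2 ++ t' :: B ++ z' :: M1)) := by
    intro w hd
    have : b ∈ z :: Q := by rw [hP]; simp
    rcases List.mem_cons.1 this with rfl | hb
    · exact hne w hd
    · exact ZZ_nbr (hQ b hb) hd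
  have hsn : ∀ w, D b w → List.IsChain D (z :: Q ++ [w]) := by
    intro w hd
    rw [hP] at hc ⊢
    exact chain_snoc hc hd
  have key := outDeg_le_length D b (wall U k₂ ++ P ++ E.drop (E.length - (k₂ - 2 - Q.length)) ++
    (z' :: M1) ++ (M2 ++ t' :: B).take (k₂ - 1) ++ (B.drop (k₂ - 2)).take (k₁ - k₂)) ?_
  · have h1 := h2.deg b
    have h2 := wall_length U k₂
    simp only [List.length_append, List.length_drop, List.length_take, List.length_cons] at key
    omega
  intro w hd
  have hwb : w ≠ b := fun e => h2.loop b (e ▸ hd)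
  rcases cases_nbr (hbn w hd) with hw | hw | hw
  · simp [hw]
  · rcases List.mem_cons.1 hw with rfl | hwM
    · have := mem_front hP (by simp) hwb
      simp [this]
    rcases List.mem_append.1 hwM with hwT | hwM1
    swap
    · simp only [List.mem_append]
      tauto
    have hT : ∀ T1 T2, M2 ++ t' :: B = T1 ++ w :: T2 →
        T1.length + 1 < k₂ ∨ k₂ - 1 + M2.length ≤ T1.length := by
      intro T1 T2 hT
      by_contra hcon
      push Not at hcon
      have hTl := congrArg List.length hT
      simp at hTl
      have := hmin (T1.length + 1) ⟨z, T1, Q, w, T2 ++ z' :: M1, ?_, ?_, hsn w hd, hn, ?_, rfl, hcon.1, ?_⟩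
      · simp at this; omega
      · have := hcy2
        rw [hT] at this
        simpa using this
      · have := hp2.trans hp
        rw [hT] at this
        simpa using this
      · rw [← ZZ_perm D k₂ U (hp2.trans hp)]; exact hQ
      · simp; omega
    have hsmall : ∀ T1 T2, M2 ++ t' :: B = T1 ++ w :: T2 → T1.length + 1 < k₂ →
        w ∈ (M2 ++ t' :: B).take (k₂ - 1) := by
      intro T1 T2 hT hl
      rw [hT]
      exact mem_take_app T1 T2 w _ (by omega)
    rcases List.mem_append.1 hwT with hwM2 | hwB
    · obtain ⟨a, c, rfl⟩ := List.append_of_mem hwM2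
      have e : a ++ w :: c ++ t' :: B = a ++ w :: (c ++ t' :: B) := by simp
      have hcase := hT _ _ e
      simp only [List.length_append, List.length_cons] at hcase
      have := hsmall _ _ e (by omega)
      simp only [List.mem_append] at this ⊢
      tauto
    rcases List.mem_cons.1 hwB with rfl | hwB
    · have hcase := hT _ _ rfl
      have := hsmall _ _ rfl (by omega)
      simp only [List.mem_append] at this ⊢
      tauto
    · obtain ⟨B1, T2, rfl⟩ := List.append_of_mem hwB
      have e : M2 ++ t' :: (B1 ++ w :: T2) = (M2 ++ t' :: B1) ++ w :: T2 := by simp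
      rcases hT _ _ e with hcase | hcase
      · have := hsmall _ _ e hcase
        simp only [List.mem_append] at this ⊢
        tauto
      simp only [List.length_append, List.length_cons] at hcase
      have hB1 : B1.length + 2 < k₁ := by
        by_contra hcon
        apply h2.nb
        apply boom_mk D k₁ k₂ z' w (E ++ t' :: B1) (M1 ++ z :: Q) ?_ ?_ ?_ ?_ ?_ ?_ ?_
        · have h3 : List.IsChain D ((t' :: B1) ++ w :: (T2 ++ [z'])) := by
            simpa using (List.isChain_split.1 hch2).2
          have := chain_glue hEc (List.isChain_split.1 h3).1
          simpa using this
        · have := chain_glue (List.isChain_split.1 hch1).1 (hsn w hd)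
          simpa using this
        · clear hsmall hT hmin hex hcyn
          simp only [List.cons_append, List.nodup_cons, List.nodup_append, List.mem_append,
            List.mem_cons, List.not_mem_nil] at hnd hEC2 ⊢
          grind
        · clear hsmall hT hmin hex hcyn
          simp only [List.cons_append, List.nodup_cons, List.nodup_append, List.mem_append,
            List.mem_cons, List.not_mem_nil] at hnd hQC ⊢
          grind
        · clear hsmall hT hmin hex hcyn
          simp only [List.cons_append, List.nodup_cons, List.nodup_append, List.mem_append,
            List.mem_cons, List.not_mem_nil] at hnd hQC hEC2 ⊢
          grind
        · simp; omega
        · simp; omega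
      have := mem_drop_take B1 T2 w (k₂ - 2) (k₁ - k₂) (by omega) (by omega)
      simp only [List.mem_append]
      exact Or.inr this
  · by_cases hwE : w ∈ E
    · obtain ⟨E1, E2, rfl⟩ := List.append_of_mem hwE
      have htail := claim2_aux (Q₀ := Q ++ w :: E2) h2 hzg ?_ ?_ ?_
      · have := mem_drop_app E1 E2 w ((E1 ++ w :: E2).length - (k₂ - 2 - Q.length))
          (by simp at htail ⊢; omega)
        simp only [List.mem_append] at this ⊢
        tauto
      · have h3 : List.IsChain D ((z' :: E1) ++ w :: (E2 ++ [t'])) := by simpa using hEc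
        have h4 : List.IsChain D ((w :: E2) ++ [t']) := by
          simpa using (List.isChain_split.1 h3).2
        have := chain_glue (hsn w hd) h4.left_of_append
        simpa using this
      · have : (w :: E2).Nodup := (List.nodup_append.1 hEn).2.1
        rw [List.nodup_append]
        refine ⟨hn, this, ?_⟩
        rintro a ha c hc rfl
        exact hQE a ha (List.mem_append_right _ hc)
      · intro x hx
        rcases List.mem_append.1 hx with hx | hx
        · exact hQ x hx
        · exact hEZ x (List.mem_append_right _ hx)
    · have := mem_front hP (List.mem_cons_of_mem _ (hmax w ⟨hw, hwE⟩ hd)) hwb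
      simp [this]

theorem exists_lol [Fintype V] [Nonempty V] (D : V → V → Prop) (hloop : ∀ v, ¬ D v v)
    (k₁ k₂ : ℕ) (hk₂ : 2 ≤ k₂) (hk : k₂ ≤ k₁) (hdeg : ∀ v, k₁ + 3 * k₂ - 5 ≤ outDeg D v) :
    ∃ U g C, Lol D k₁ U g C := by
  by_contra hno
  obtain ⟨P, ⟨hPc, hPn, hPne⟩, hmax⟩ := exists_max_nat
    (fun P : List V => List.IsChain D P ∧ P.Nodup ∧ P ≠ []) List.length (Fintype.card V)
    ⟨[Classical.arbitrary V], by simp, by simp, by simp⟩ (fun P hP => hP.2.1.length_le_card)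
  obtain ⟨P0, b, rfl⟩ : ∃ P0 b, P = P0 ++ [b] :=
    ⟨P.dropLast, P.getLast hPne, (List.dropLast_append_getLast hPne).symm⟩
  have key := outDeg_le_length D b (P0.drop (P0.length - (k₁ - 1))) ?_
  · have := hdeg b
    simp only [List.length_drop] at key
    omega
  intro w hd
  have hwb : w ≠ b := fun e => hloop b (e ▸ hd)
  have hwP : w ∈ P0 := by
    by_contra hw
    have := hmax (P0 ++ [b] ++ [w]) ⟨chain_snoc hPc hd, ?_, by simp⟩
    · simp at this
    · have : w ∉ P0 ++ [b] := by simp [hw, hwb]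
      rw [List.nodup_append]
      refine ⟨hPn, by simp, ?_⟩
      rintro a ha c hc rfl
      simp at hc
      exact this (hc ▸ ha)
  obtain ⟨P1, P2, rfl⟩ := List.append_of_mem hwP
  apply mem_drop_app
  by_contra hlen
  apply hno
  refine ⟨[], w, w :: (P2 ++ [b]), cyc_mk ?_ ?_, by simp, by simp, by simp, by simp, ?_⟩
  · have : (P1 ++ (w :: (P2 ++ [b]))).Nodup := by simpa using hPn
    exact (List.nodup_append.1 this).2.1
  · have : List.IsChain D (P1 ++ w :: (P2 ++ [b] ++ [w])) := by
      simpa using chain_snoc hPc hd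
    simpa using (List.isChain_split.1 this).2
  · simp at hlen ⊢; omega

theorem main_aux [Fintype V] [Nonempty V] (D : V → V → Prop) (hloop : ∀ v, ¬ D v v)
    (k₁ k₂ : ℕ) (hk₂ : 2 ≤ k₂) (hk : k₂ ≤ k₁) (hdeg : ∀ v, k₁ + 3 * k₂ - 5 ≤ outDeg D v) :
    Boom D k₁ k₂ := by
  by_contra nb
  obtain ⟨U0, g0, C0, hL0⟩ := exists_lol D hloop k₁ k₂ hk₂ hk hdeg
  obtain ⟨⟨U, g⟩, ⟨C1, hL1⟩, hmaxU⟩ := exists_max_nat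
    (fun p : List V × V => ∃ C, Lol D k₁ p.1 p.2 C) (fun p => p.1.length) (Fintype.card V)
    ⟨(U0, g0), C0, hL0⟩ (fun p ⟨C, hC⟩ => hC.nd.length_le_card)
  obtain ⟨C2, hL2, hmaxY⟩ := exists_max_nat
    (fun C : List V => Lol D k₁ U g C) (fun C => (YY D k₂ U C).ncard) (Nat.card V)
    ⟨C1, hL1⟩ (fun C _ => Set.ncard_le_card _)
  obtain ⟨C, ⟨hL, hYC⟩, hmaxC⟩ := exists_max_nat
    (fun C : List V => Lol D k₁ U g C ∧ (YY D k₂ U C).ncard = (YY D k₂ U C2).ncard) List.length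
    (Fintype.card V) ⟨C2, hL2, rfl⟩ (fun C hC => hC.1.cyc.nodup.length_le_card)
  refine claim5 (D := D) (k₁ := k₁) (k₂ := k₂) (U := U) (g := g) (C := C)
    ⟨hL, hloop, ?_, ?_, nb, hk₂, hk, hdeg⟩
  · intro U' g' C' h'
    exact hmaxU (U', g') ⟨C', h'⟩
  · intro C' h'
    rw [hYC]
    exact ⟨hmaxY C' h', fun e => hmaxC C' ⟨h', e⟩⟩

end Helpers

end Paper

namespace Paper

/-- For `k₁ ≥ k₂ ≥ 2`, every digraph with minimum out-degree at least
`k₁ + 3k₂ − 5` contains a subdivision of `C(k₁,k₂)`: two distinct vertices `x, y` and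
two internally vertex-disjoint directed paths from `x` to `y`, of length at least `k₁`
and at least `k₂` respectively. -/
theorem stmt_3 {V : Type*} [Fintype V] [Nonempty V] (D : V → V → Prop)
    (hloop : ∀ v, ¬ D v v) (k₁ k₂ : ℕ) (hk₂ : 2 ≤ k₂) (hk : k₂ ≤ k₁)
    (hdeg : ∀ v, k₁ + 3 * k₂ - 5 ≤ outDeg D v) :
    ∃ (x y : V) (p q : List V), x ≠ y ∧
      IsDipathList D p ∧ p.head? = some x ∧ p.getLast? = some y ∧ k₁ + 1 ≤ p.length ∧
      IsDipathList D q ∧ q.head? = some x ∧ q.getLast? = some y ∧ k₂ + 1 ≤ q.length ∧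
      (∀ z ∈ p, z ∈ q → z = x ∨ z = y) := by
  exact main_aux D hloop k₁ k₂ hk₂ hk hdeg

end Paper
end

section
/- There is an absolute constant C such that for every pair of integers a ≥ 2 and b ≥ 1, every digraph D with minimum out-degree δ+(D) ≥ C·a·b^7 and directed girth at least 4b² contains a subdivision of C_{a,b}. -/
namespace Paper
open Classical

/-- direction relation of block `j` -/
def dr {V : Type} (H : V → V → Prop) (j : ℕ) : V → V → Prop :=
  fun y z => if j % 2 = 0 then H y z else H z y

/-- Alternating path from `x`, currently in block `j`, of which `m` arcs are used, ending at `y`,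
with vertex list `l`; every finished block has length at least `b`. -/
inductive AP {V : Type} (H : V → V → Prop) (b : ℕ) (x : V) : ℕ → ℕ → V → List V → Prop
  | nil : AP H b x 0 0 x [x]
  | step {j m : ℕ} {y : V} {l : List V} {z : V} :
      AP H b x j m y l → z ∉ l → dr H j y z → AP H b x j (m + 1) z (z :: l)
  | turn {j m : ℕ} {y : V} {l : List V} :
      AP H b x j m y l → b ≤ m → AP H b x (j + 1) 0 y l

/-- walks of given length -/
def Wk {V : Type} (H : V → V → Prop) : ℕ → V → V → Prop
  | 0, x, y => x = y
  | n + 1, x, y => ∃ z, H x z ∧ Wk H n z y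

/-- restriction to a vertex set -/
def HR {V : Type} (H : V → V → Prop) (R : Finset V) : V → V → Prop :=
  fun x y => H x y ∧ x ∈ R ∧ y ∈ R

variable {V : Type}

theorem AP.end_mem {H : V → V → Prop} {b : ℕ} {x : V} {j m : ℕ} {y : V} {l : List V}
    (h : AP H b x j m y l) : y ∈ l := by
  induction h with
  | nil => simp
  | step _ _ _ _ => simp
  | turn _ _ ih => exact ih

theorem AP.mono {H H' : V → V → Prop} {b : ℕ} {x : V} {j m : ℕ} {y : V} {l : List V}
    (h : AP H b x j m y l) (hm : ∀ y ∈ l, ∀ z ∈ l, H y z → H' y z) : AP H' b x j m y l := by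
  induction h with
  | nil => exact .nil
  | @step j m y l z h1 h2 h3 ih =>
    refine .step (ih fun y hy z hz => hm y (by simp [hy]) z (by simp [hz])) h2 ?_
    unfold dr at *
    have := h1.end_mem
    split_ifs at * <;> exact hm _ (by simp [this]) _ (by simp [this]) h3
  | turn _ h2 ih => exact .turn (ih hm) h2

theorem AP.append {H : V → V → Prop} {b : ℕ} {x : V} {j : ℕ} (p : List V) :
    ∀ {m : ℕ} {y : V} {l : List V}, AP H b x j m y l → List.IsChain (dr H j) (y :: p) →
      p.Nodup → (∀ z ∈ p, z ∉ l) →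
      AP H b x j (m + p.length) ((y :: p).getLast (by simp)) (p.reverse ++ l) := by
  induction p with
  | nil => intro m y l h _ _ _; simpa using h
  | cons z p ih =>
    intro m y l h hc hn hd
    have h1 : AP H b x j (m+1) z (z :: l) := .step h (hd z (by simp)) (by
      rw [List.isChain_cons_cons] at hc; exact hc.1)
    have := ih h1 (by rw [List.isChain_cons_cons] at hc; exact hc.2) (List.nodup_cons.1 hn).2 (by
      intro w hw
      have : w ≠ z := by rintro rfl; exact (List.nodup_cons.1 hn).1 hw
      simp [this, hd w (by simp [hw])])
    simpa [Nat.add_assoc, Nat.add_comm 1] using this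

theorem Wk.mono {H H' : V → V → Prop} (hm : ∀ x y, H x y → H' x y) :
    ∀ {n : ℕ} {x y : V}, Wk H n x y → Wk H' n x y
  | 0, _, _, h => h
  | _ + 1, _, _, ⟨z, h1, h2⟩ => ⟨z, hm _ _ h1, Wk.mono hm h2⟩

theorem Wk.trans {H : V → V → Prop} {n : ℕ} : ∀ {m : ℕ} {x y z : V}, Wk H m x y → Wk H n y z →
    Wk H (m + n) x z
  | 0, _, _, _, h, h' => by cases h; simpa using h'
  | m + 1, _, _, _, ⟨w, h1, h2⟩, h' => by
    rw [show m + 1 + n = (m + n) + 1 by omega]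
    exact ⟨w, h1, Wk.trans h2 h'⟩

theorem Wk.one {H : V → V → Prop} {x y : V} (h : H x y) : Wk H 1 x y := ⟨y, h, rfl⟩

/-- from a walk to a path -/
theorem Wk.path {H : V → V → Prop} : ∀ {n : ℕ} {x y : V}, Wk H n x y →
    ∃ p : List V, List.IsChain H (x :: p) ∧ (x :: p).Nodup ∧
      (x :: p).getLast (by simp) = y ∧ p.length ≤ n
  | 0, x, y, h => ⟨[], by simp, by simp, by simpa [Wk] using h, by simp⟩
  | n + 1, x, y, ⟨z, h1, h2⟩ => by
    obtain ⟨p, hc, hn, hl, hlen⟩ := Wk.path h2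
    by_cases hx : x ∈ z :: p
    · obtain ⟨s, t, hst⟩ := List.append_of_mem hx
      have hlen' : (z :: p).length = (s ++ x :: t).length := by rw [hst]
      simp at hlen'
      refine ⟨t, ?_, ?_, ?_, by omega⟩
      · rw [hst] at hc; exact (List.isChain_append.1 hc).2.1
      · rw [hst] at hn; exact (List.nodup_append.1 hn).2.1
      · rw [← hl]; simp [hst]
    · exact ⟨z :: p, by rw [List.isChain_cons_cons]; exact ⟨h1, hc⟩,
        List.nodup_cons.2 ⟨hx, hn⟩, by simpa using hl, by simpa using hlen⟩

/-- a chain gives a walk -/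
theorem Wk.ofChain {H : V → V → Prop} : ∀ {p : List V} {x : V}, List.IsChain H (x :: p) →
    Wk H p.length x ((x :: p).getLast (by simp))
  | [], x, _ => by simp [Wk]
  | z :: p, x, h => by
    rw [List.isChain_cons_cons] at h
    have := Wk.ofChain h.2
    exact ⟨z, h.1, by simpa using this⟩

/-- short chains in a relation of large girth have distinct vertices -/
theorem nodup_of_girth {H : V → V → Prop} {b : ℕ} (hg : ∀ n x, 0 < n → n ≤ b → ¬ Wk H n x x) :
    ∀ {p : List V}, List.IsChain H p → p.length ≤ b + 1 → p.Nodup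
  | [], _, _ => by simp
  | x :: p, h, hl => by
    simp at hl
    have hp : List.IsChain H p := h.tail
    refine List.nodup_cons.2 ⟨fun hx => ?_, nodup_of_girth hg hp (by omega)⟩
    obtain ⟨s, t, hst⟩ := List.append_of_mem hx
    have : List.IsChain H ((x :: s ++ [x]) ++ t) := by rw [hst] at h; simpa using h
    have := (List.isChain_append.1 this).1
    have := Wk.ofChain (p := s ++ [x]) (by simpa using this)
    have hlen : p.length = s.length + t.length + 1 := by rw [hst]; simp; omega
    refine hg _ x ?_ ?_ (by simpa using this)
    · simp
    · omega

theorem girth_of_dirGirth {D : V → V → Prop} {b g : ℕ} (hb : b < g) (h : DirGirthGE D g) :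
    ∀ n x, 0 < n → n ≤ b → ¬ Wk D n x x := by
  rintro (_ | n) x h0 hn hw
  · omega
  obtain ⟨z, h1, h2⟩ := hw
  obtain ⟨p, hc, hnd, hl, hlen⟩ := h2.path
  have e : (z :: p).dropLast ++ [x] = z :: p := by
    conv_rhs => rw [← List.dropLast_append_getLast (l := z :: p) (by simp)]
    rw [hl]
  have := h x (z :: p).dropLast (by
      rw [← e] at hnd
      have := (List.perm_append_comm (l₁ := (z :: p).dropLast) (l₂ := [x])).nodup_iff.1 hnd
      simpa using this) (by
      rw [e]
      exact List.isChain_cons_cons.2 ⟨h1, hc⟩)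
  simp at this
  omega

end Paper

namespace Paper
open Classical
variable {V : Type}

theorem AP.extract {H : V → V → Prop} {b : ℕ} {x : V} {j m : ℕ} {y : V} {l : List V}
    (h : AP H b x j m y l) : ∃ (c : ℕ → V) (blk : ℕ → ℕ), c 0 = x ∧ blk 0 = 0 ∧
      c (blk j + m) = y ∧ (∀ j' < j, blk j' + b ≤ blk (j' + 1)) ∧ (∀ j' ≤ j, blk j' ≤ blk j) ∧
      (∀ j' < j, ∀ i, blk j' ≤ i → i < blk (j' + 1) → dr H j' (c i) (c (i + 1))) ∧
      (∀ i, blk j ≤ i → i < blk j + m → dr H j (c i) (c (i + 1))) ∧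
      (∀ i ≤ blk j + m, c i ∈ l) ∧
      (∀ i i', i < i' → i' ≤ blk j + m → c i ≠ c i') := by
  induction h with
  | nil =>
    refine ⟨fun _ => x, fun _ => 0, ?_⟩
    simp
    intros
    omega
  | @step j m y l z h1 h2 h3 ih =>
    obtain ⟨c, blk, a1, a2, a3, a4, a5, a6, a7, a8, a9⟩ := ih
    have upd : ∀ i ≤ blk j + m, Function.update c (blk j + m + 1) z i = c i := by
      intro i hi
      exact Function.update_of_ne (by omega) _ _
    have updn : Function.update c (blk j + m + 1) z (blk j + m + 1) = z := Function.update_self ..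
    refine ⟨Function.update c (blk j + m + 1) z, blk, ?_, a2, ?_, a4, a5, ?_, ?_, ?_, ?_⟩
    · rw [upd _ (by omega), a1]
    · exact updn
    · intro j' hj i h4 h5
      have := a5 (j' + 1) (by omega)
      rw [upd _ (by omega), upd _ (by omega)]
      exact a6 j' hj i h4 h5
    · intro i h4 h5
      by_cases hi : i = blk j + m
      · subst hi
        rw [upd _ le_rfl, updn, a3]; exact h3
      · rw [upd _ (by omega), upd _ (by omega)]
        exact a7 i h4 (by omega)
    · intro i hi
      by_cases hi' : i = blk j + m + 1
      · subst hi'; rw [updn]; simp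
      · rw [upd _ (by omega)]; exact List.mem_cons_of_mem _ (a8 i (by omega))
    · intro i i' h4 h5
      by_cases hi' : i' = blk j + m + 1
      · subst hi'; rw [updn, upd _ (by omega)]
        rintro rfl; exact h2 (a8 i (by omega))
      · rw [upd _ (by omega), upd _ (by omega)]; exact a9 i i' h4 (by omega)
  | @turn j m y l h1 h2 ih =>
    obtain ⟨c, blk, a1, a2, a3, a4, a5, a6, a7, a8, a9⟩ := ih
    have upd : ∀ i ≤ j, Function.update blk (j + 1) (blk j + m) i = blk i := by
      intro i hi
      exact Function.update_of_ne (by omega) _ _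
    have updn : Function.update blk (j + 1) (blk j + m) (j + 1) = blk j + m :=
      Function.update_self ..
    refine ⟨c, Function.update blk (j + 1) (blk j + m), a1, ?_, ?_, ?_, ?_, ?_, ?_, ?_, ?_⟩
    · rw [upd _ (by omega), a2]
    · rw [updn]; exact a3
    · intro j' hj
      by_cases hj' : j' = j
      · subst hj'; rw [updn, upd _ le_rfl]; omega
      · rw [upd _ (by omega), upd _ (by omega)]; exact a4 j' (by omega)
    · intro j' hj
      by_cases hj' : j' = j + 1
      · subst hj'; rfl
      · rw [upd _ (by omega), updn]
        have := a5 j' (by omega)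
        omega
    · intro j' hj i
      by_cases hj' : j' = j
      · subst hj'; rw [updn, upd _ le_rfl]; exact a7 i
      · rw [upd _ (by omega), upd _ (by omega)]; exact a6 j' (by omega) i
    · intro i; rw [updn]; omega
    · rw [updn]; exact a8
    · rw [updn]; exact a9

theorem Cab_iff {a b : ℕ} (ha : 2 ≤ a) (hb : 1 ≤ b) (x y : ZMod (2 * a * b)) :
    Cab a b x y ↔ (y = x + 1 ∧ (x.val / b) % 2 = 0) ∨ (x = y + 1 ∧ (y.val / b) % 2 = 1) := by
  have hn : 0 < 2 * a * b := by positivity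
  haveI : NeZero (2 * a * b) := ⟨hn.ne'⟩
  constructor
  · rintro ⟨i, hi, ⟨h1, rfl, rfl⟩ | ⟨h1, rfl, rfl⟩⟩
    · left; rw [ZMod.val_cast_of_lt hi]; exact ⟨by push_cast; rfl, h1⟩
    · right; rw [ZMod.val_cast_of_lt hi]; exact ⟨by push_cast; rfl, h1⟩
  · rintro (⟨rfl, h⟩ | ⟨rfl, h⟩)
    · exact ⟨x.val, ZMod.val_lt x, .inl ⟨h, by simp, by simp⟩⟩
    · exact ⟨y.val, ZMod.val_lt y, .inr ⟨h, by simp, by simp⟩⟩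

theorem two_ne_zero_Cab {a b : ℕ} (ha : 2 ≤ a) (hb : 1 ≤ b) (x : ZMod (2 * a * b)) :
    x ≠ x + 1 + 1 := by
  intro h
  have h2 : ((2 : ℕ) : ZMod (2 * a * b)) = 0 := by
    have : x + 0 = x + (1 + 1) := by rw [add_zero, ← add_assoc]; exact h
    have := add_left_cancel this
    rw [this]; push_cast; norm_num
  rw [ZMod.natCast_eq_zero_iff] at h2
  have := Nat.le_of_dvd (by norm_num) h2
  nlinarith

/-- The vertex list of positions `s, …, s + d + 1`. -/
def seg (c : ℕ → V) (s d : ℕ) : List V :=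
  c s :: ((List.range d).map (fun t => c (s + 1 + t)) ++ [c (s + d + 1)])

theorem seg_eq (c : ℕ → V) (s d : ℕ) :
    seg c s d = (List.range (d + 2)).map (fun t => c (s + t)) := by
  unfold seg
  rw [List.range_succ, List.range_succ_eq_map]
  simp [Function.comp_def, Nat.add_assoc, Nat.add_comm, Nat.add_left_comm]

theorem seg_chain {c : ℕ → V} {s d : ℕ} {Q : V → V → Prop}
    (h : ∀ t, s ≤ t → t < s + d + 1 → Q (c t) (c (t + 1))) : List.IsChain Q (seg c s d) := by
  rw [seg_eq, List.isChain_iff_getElem]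
  intro i hi
  simp at hi ⊢
  exact h (s + i) (by omega) (by omega)

theorem mem_seg {c : ℕ → V} {s d : ℕ} {z : V} :
    z ∈ seg c s d ↔ ∃ t, s ≤ t ∧ t ≤ s + d + 1 ∧ c t = z := by
  rw [seg_eq]
  simp only [List.mem_map, List.mem_range]
  constructor
  · rintro ⟨t, h, rfl⟩; exact ⟨s + t, by omega, by omega, rfl⟩
  · rintro ⟨t, h, h', rfl⟩; exact ⟨t - s, by omega, by congr 1; omega⟩

theorem seg_nodup {c : ℕ → V} {s d : ℕ}
    (h : ∀ t t', s ≤ t → t < t' → t' ≤ s + d + 1 → c t ≠ c t') : (seg c s d).Nodup := by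
  rw [seg_eq]
  refine List.Nodup.map_on ?_ List.nodup_range
  intro t ht t' ht' e
  simp at ht ht'
  rcases lt_trichotomy t t' with h1 | h1 | h1
  · exact absurd e (h _ _ (by omega) (by omega) (by omega))
  · exact h1
  · exact absurd e.symm (h _ _ (by omega) (by omega) (by omega))

theorem mem_seg_mid {c : ℕ → V} {s d : ℕ} {z : V} :
    z ∈ (seg c s d).tail.dropLast ↔ ∃ t, s < t ∧ t < s + d + 1 ∧ c t = z := by
  simp only [seg, List.tail_cons, List.dropLast_concat, List.mem_map, List.mem_range]
  constructor
  · rintro ⟨t, h, rfl⟩; exact ⟨s + 1 + t, by omega, by omega, rfl⟩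
  · rintro ⟨t, h, h', rfl⟩; exact ⟨t - s - 1, by omega, by congr 1; omega⟩

theorem mem_seg_rev_mid {c : ℕ → V} {s d : ℕ} {z : V} :
    z ∈ (seg c s d).reverse.tail.dropLast ↔ ∃ t, s < t ∧ t < s + d + 1 ∧ c t = z := by
  rw [← mem_seg_mid]
  simp [seg]

theorem sub_of_pos {a b : ℕ} (ha : 2 ≤ a) (hb : 1 ≤ b) {H : V → V → Prop} (c : ℕ → V)
    (pos : ℕ → ℕ) (h0 : pos 0 = 0) (hm : ∀ i < 2 * a * b, pos i < pos (i + 1))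
    (hc : c (pos (2 * a * b)) = c 0)
    (hinj : ∀ t t', t < t' → t' < pos (2 * a * b) → c t ≠ c t')
    (hd : ∀ i < 2 * a * b, ∀ t, pos i ≤ t → t < pos (i + 1) → dr H (i / b) (c t) (c (t + 1))) :
    ContainsSubdivisionOf H (Cab a b) := by
  have hn4 : 4 ≤ 2 * a * b := by nlinarith
  have hF := @Cab_iff a b ha hb
  have h2 := @two_ne_zero_Cab a b ha hb
  generalize Cab a b = F at *
  generalize 2 * a * b = n at *
  haveI : NeZero n := ⟨by omega⟩
  have mono : ∀ i j, i ≤ j → j ≤ n → pos i ≤ pos j := by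
    intro i j hij
    induction j, hij using Nat.le_induction with
    | base => intro _; exact le_rfl
    | succ j hj ih => intro hjn; have := ih (by omega); have := hm j (by omega); omega
  have smono : ∀ i j, i < j → j ≤ n → pos i < pos j := by
    intro i j hij hj
    have := mono (i+1) j hij hj
    have := hm i (by omega)
    omega
  have inj' : ∀ t t', t < pos n → t' < pos n → c t = c t' → t = t' := by
    intro t t' h1 h2 e
    rcases lt_trichotomy t t' with h | h | h
    · exact absurd e (hinj _ _ h h2)
    · exact h
    · exact absurd e.symm (hinj _ _ h h1)
  have hsucc : ∀ x : ZMod n, c (pos (x + 1).val) = c (pos (x.val + 1)) := by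
    intro x
    have hx := ZMod.val_lt x
    by_cases h : x.val + 1 < n
    · have e : x + 1 = ((x.val + 1 : ℕ) : ZMod n) := by simp
      rw [e, ZMod.val_cast_of_lt h]
    · have e : x.val + 1 = n := by omega
      have : x + 1 = 0 := by
        have : ((x.val + 1 : ℕ) : ZMod n) = 0 := by rw [e]; simp
        simpa using this
      rw [this, e, hc, ZMod.val_zero, h0]
  -- the segments
  let sg : ℕ → List V := fun i => seg c (pos i) (pos (i + 1) - pos i - 1)
  have hlast : ∀ i < n, pos i + (pos (i + 1) - pos i - 1) + 1 = pos (i + 1) := by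
    intro i hi; have := hm i hi; omega
  have sgn : ∀ i < n, (sg i).Nodup := by
    intro i hi
    apply seg_nodup
    intro t t' h1 h2 h3 e
    rw [hlast i hi] at h3
    have h4 := mono (i+1) n (by omega) le_rfl
    by_cases ht' : t' < pos n
    · exact hinj t t' h2 ht' e
    · have e' : t' = pos n := by omega
      have : t = 0 := by
        apply inj' t 0 (by omega) (by omega)
        rw [e, e', hc]
      have i0 : i = 0 := by
        by_contra hne
        have := smono 0 i (by omega) (by omega)
        omega
      have := smono (i+1) n (by omega) le_rfl
      omega
  have sgi : ∀ i < n, ∀ t, pos i < t → t < pos (i+1) → ∀ j < n, j ≠ i → c t ∉ sg j := by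
    intro i hi t h1 h2 j hj hne hmem
    obtain ⟨t', h3, h4, h5⟩ := mem_seg.1 hmem
    rw [hlast j hj] at h4
    have := mono (i+1) n (by omega) le_rfl
    have := mono (j+1) n (by omega) le_rfl
    have e : t = t' ∨ t = 0 := by
      by_cases h : t' < pos n
      · left; exact inj' _ _ (by omega) h h5.symm
      · right
        apply inj' _ _ (by omega) (by omega)
        rw [← h5, show t' = pos n by omega, hc]
    rcases e with e | e
    · rcases lt_or_gt_of_ne hne with h | h
      · have := mono (j+1) i h (by omega); omega
      · have := mono (i+1) j h (by omega); omega
    · omega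
  have sgb : ∀ i < n, ∀ t, pos i < t → t < pos (i+1) → ∀ w : ZMod n, c (pos w.val) ≠ c t := by
    intro i hi t h1 h2 w e
    have hw := ZMod.val_lt w
    have := smono w.val n hw le_rfl
    have := mono (i+1) n (by omega) le_rfl
    have := inj' _ _ (by omega) (by omega) e
    by_cases h : w.val ≤ i
    · have := mono _ _ h (by omega); omega
    · have := mono (i+1) w.val (by omega) (by omega); omega
  -- description of the paths
  let P : ZMod n → ZMod n → List V := fun x y =>
    if y = x + 1 ∧ (x.val / b) % 2 = 0 then sg x.val else (sg y.val).reverse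
  have key : ∀ x y, F x y → ∃ i < n, (∀ z, z ∈ P x y ↔ z ∈ sg i) ∧
      (∀ z, z ∈ (P x y).tail.dropLast ↔ z ∈ (sg i).tail.dropLast) ∧
      ((P x y = sg i ∧ i = x.val ∧ y = x + 1 ∧ (i / b) % 2 = 0) ∨
        (P x y = (sg i).reverse ∧ i = y.val ∧ x = y + 1 ∧ (i / b) % 2 = 1)) := by
    intro x y hxy
    rcases (hF x y).1 hxy with ⟨h1, h3⟩ | ⟨h1, h3⟩
    · have : P x y = sg x.val := if_pos ⟨h1, h3⟩
      exact ⟨x.val, ZMod.val_lt x, by simp [this], by simp [this], .inl ⟨this, rfl, h1, h3⟩⟩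
    · have : P x y = (sg y.val).reverse := if_neg (by
        rintro ⟨h4, -⟩
        rw [h1] at h4; exact h2 _ h4)
      refine ⟨y.val, ZMod.val_lt y, by simp [this], ?_, .inr ⟨this, rfl, h1, h3⟩⟩
      intro z; rw [this]; exact mem_seg_rev_mid.trans mem_seg_mid.symm
  refine ⟨fun x => c (pos x.val), P, ?_, ?_, ?_⟩
  · intro x y e
    have hx := ZMod.val_lt x
    have hy := ZMod.val_lt y
    have e1 := inj' _ _ (smono _ _ hx le_rfl) (smono _ _ hy le_rfl) e
    apply ZMod.val_injective
    rcases lt_trichotomy x.val y.val with h | h | h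
    · have := smono _ _ h hy.le; omega
    · exact h
    · have := smono _ _ h hx.le; omega
  · intro x y hxy
    obtain ⟨i, hi, k1, k2, k3⟩ := key x y hxy
    have hmid : ∀ z ∈ (P x y).tail.dropLast, ∀ w : ZMod n, c (pos w.val) ≠ z := by
      intro z hz w
      obtain ⟨t, h1, h3, rfl⟩ := mem_seg_mid.1 ((k2 z).1 hz)
      rw [hlast i hi] at h3
      exact sgb i hi t h1 h3 w
    have hch : List.IsChain (dr H (i / b)) (sg i) := by
      apply seg_chain
      intro t h1 h3
      rw [hlast i hi] at h3
      exact hd i hi t h1 h3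
    rcases k3 with ⟨e1, e2, e3, e4⟩ | ⟨e1, e2, e3, e4⟩
    · refine ⟨⟨?_, ?_, ?_⟩, ?_, ?_, ?_, hmid⟩
      · rw [e1]; simp [sg, seg]
      · rw [e1]; exact sgn i hi
      · rw [e1]
        have : dr H (i / b) = H := by funext u w; simp [dr, e4]
        rw [this] at hch; exact hch
      · rw [e1]; simp [sg, seg, e2]
      · rw [e1, e3]
        show _ = some (c (pos (x + 1).val))
        rw [hsucc, ← e2, ← hlast i hi]; simp [sg, seg, List.getLast?_cons]
      · rw [e1]; simp [sg, seg]
    · refine ⟨⟨?_, ?_, ?_⟩, ?_, ?_, ?_, hmid⟩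
      · rw [e1]; simp [sg, seg]
      · rw [e1]; exact List.nodup_reverse.2 (sgn i hi)
      · rw [e1]
        have : dr H (i / b) = flip H := by funext u w; simp [dr, e4, flip]
        rw [this] at hch; exact List.isChain_reverse.2 hch
      · rw [e1, e3]
        show _ = some (c (pos (y + 1).val))
        rw [hsucc, ← e2, ← hlast i hi]; simp [sg, seg, List.getLast?_cons]
      · rw [e1, List.getLast?_reverse]; simp [sg, seg, e2]
      · rw [e1]; simp [sg, seg]
  · intro x y x' y' hxy hxy' hne z hz hz'
    obtain ⟨i, hi, k1, k2, k3⟩ := key x y hxy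
    obtain ⟨i', hi', k1', k2', k3'⟩ := key x' y' hxy'
    obtain ⟨t, h1, h3, rfl⟩ := mem_seg_mid.1 ((k2 z).1 hz)
    rw [hlast i hi] at h3
    refine sgi i hi t h1 h3 i' hi' ?_ ((k1' _).1 hz')
    rintro rfl
    apply hne
    rcases k3 with ⟨-, e2, e3, e4⟩ | ⟨-, e2, e3, e4⟩ <;>
    rcases k3' with ⟨-, e2', e3', e4'⟩ | ⟨-, e2', e3', e4'⟩
    · have : x = x' := ZMod.val_injective _ (by omega)
      rw [e3, e3', this]
    · omega
    · omega
    · have : y = y' := ZMod.val_injective _ (by omega)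
      rw [e3, e3', this]

end Paper

namespace Paper
open Classical
variable {V : Type}

theorem sub_of_blk {a b : ℕ} (ha : 2 ≤ a) (hb : 1 ≤ b) {H : V → V → Prop} (c : ℕ → V)
    (blk : ℕ → ℕ) (h0 : blk 0 = 0) (hm : ∀ j < 2 * a, blk j + b ≤ blk (j + 1))
    (hc : c (blk (2 * a)) = c 0)
    (hinj : ∀ t t', t < t' → t' < blk (2 * a) → c t ≠ c t')
    (hd : ∀ j < 2 * a, ∀ t, blk j ≤ t → t < blk (j + 1) → dr H j (c t) (c (t + 1))) :
    ContainsSubdivisionOf H (Cab a b) := by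
  have hN : blk (2 * a * b / b) + 2 * a * b % b = blk (2 * a) := by
    rw [Nat.mul_div_cancel _ (by omega), Nat.mul_mod_left]; rfl
  have hdiv : ∀ i < 2 * a * b, i / b < 2 * a := fun i hi => Nat.div_lt_of_lt_mul (by
    rw [mul_comm]; exact hi)
  have hsucc : ∀ i, ((i + 1) / b = i / b ∧ (i + 1) % b = i % b + 1) ∨
      ((i + 1) / b = i / b + 1 ∧ (i + 1) % b = 0 ∧ i % b + 1 = b) := by
    intro i
    have h1 := Nat.mod_lt i (show 0 < b by omega)
    have h2 := Nat.div_add_mod i b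
    by_cases h : i % b + 1 < b
    · left
      have e : i + 1 = (i % b + 1) + b * (i / b) := by omega
      constructor
      · rw [e, Nat.add_mul_div_left _ _ (by omega), Nat.div_eq_of_lt h]; omega
      · rw [e, Nat.add_mul_mod_self_left, Nat.mod_eq_of_lt h]
    · right
      have e : i + 1 = b * (i / b + 1) := by rw [Nat.mul_add]; omega
      refine ⟨?_, ?_, by omega⟩
      · rw [e, Nat.mul_div_cancel_left _ (by omega)]
      · rw [e, Nat.mul_mod_right]
  refine sub_of_pos ha hb c (fun i => blk (i / b) + i % b) (by simp [h0]) ?_ ?_ ?_ ?_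
  · intro i hi
    have := hm _ (hdiv i hi)
    rcases hsucc i with ⟨h1, h2⟩ | ⟨h1, h2, h3⟩
    · simp only [h1, h2]; omega
    · simp only [h1, h2]; omega
  · simp only [hN]; exact hc
  · simp only [hN]; exact hinj
  · intro i hi t h1 h2
    have := hm _ (hdiv i hi)
    have := Nat.mod_lt i (show 0 < b by omega)
    apply hd _ (hdiv i hi) t (by omega)
    rcases hsucc i with ⟨h3, h4⟩ | ⟨h3, h4, h5⟩
    · simp only [h3, h4] at h2; omega
    · simp only [h3, h4] at h2; omega

/-- closing an alternating path to an alternating cycle -/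
theorem sub_of_AP {a b : ℕ} (ha : 2 ≤ a) (hb : 1 ≤ b) {H : V → V → Prop} {x w : V} {m : ℕ}
    {l : List V} (h : AP H b x (2 * a) m w l) (hm : b ≤ m) (hw : H w x) :
    ContainsSubdivisionOf H (Cab a b) := by
  obtain ⟨c, blk, a1, a2, a3, a4, a5, a6, a7, a8, a9⟩ := h.extract
  set B := blk (2 * a) with hB
  -- the rotated cycle
  let c' : ℕ → V := fun i => if i ≤ m then c (B + i) else if i ≤ B + m then c (i - (m + 1))
    else c B
  have e1 : ∀ i ≤ m, c' i = c (B + i) := fun i hi => if_pos hi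
  have e2 : ∀ i, m < i → i ≤ B + m → c' i = c (i - (m + 1)) := fun i hi h' => by
    simp only [c']; rw [if_neg (by omega), if_pos h']
  have hb1 : blk 1 ≤ B := a5 1 (by omega)
  have hb0 : blk 0 + b ≤ blk 1 := a4 0 (by omega)
  let blk' : ℕ → ℕ := fun j => if j = 0 then 0 else m + 1 + blk j
  have f1 : ∀ j, 0 < j → blk' j = m + 1 + blk j := fun j hj => if_neg (by omega)
  have f0 : blk' 0 = 0 := if_pos rfl
  refine sub_of_blk ha hb c' blk' f0 ?_ ?_ ?_ ?_
  · intro j hj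
    rw [f1 (j + 1) (by omega)]
    have := a4 j hj
    rcases Nat.eq_zero_or_pos j with h | h
    · subst h; rw [f0]; omega
    · rw [f1 _ h]; omega
  · rw [f1 _ (by omega), e1 0 (by omega), ← hB]
    simp only [c']; rw [if_neg (by omega), if_neg (by omega)]; rfl
  · intro t t' h1 h2
    rw [f1 _ (by omega), ← hB] at h2
    by_cases ht : t ≤ m
    · rw [e1 _ ht]
      by_cases ht' : t' ≤ m
      · rw [e1 _ ht']; exact a9 _ _ (by omega) (by omega)
      · rw [e2 _ (by omega) (by omega)]; exact (a9 _ _ (by omega) (by omega)).symm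
    · rw [e2 _ (by omega) (by omega), e2 _ (by omega) (by omega)]
      exact a9 _ _ (by omega) (by omega)
  · intro j hj t h1 h2
    rw [f1 (j + 1) (by omega)] at h2
    have hjB := a5 (j + 1) hj
    have hcirc : c' (t + 1) = c (t - m) ∨ t < m := by
      by_cases h : t < m
      · exact .inr h
      · left
        by_cases h' : t + 1 ≤ B + m
        · rw [e2 _ (by omega) h']; congr 1; omega
        · simp only [c']; rw [if_neg (by omega), if_neg h']; congr 1; omega
    rcases Nat.eq_zero_or_pos j with h | h
    · subst h
      by_cases ht : t < m
      · rw [e1 _ ht.le, e1 _ (by omega)]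
        have := a7 (B + t) (by omega) (by omega)
        simpa [dr, Nat.add_assoc] using this
      · rcases hcirc with hcirc | hcirc
        · rw [hcirc]
          by_cases htm : t = m
          · subst htm
            rw [e1 _ le_rfl, a3]; simpa [dr, a1] using hw
          · rw [e2 _ (by omega) (by omega)]
            have := a6 0 hj (t - (m + 1)) (by omega) (by omega)
            rwa [show t - (m + 1) + 1 = t - m by omega] at this
        · omega
    · rw [f1 _ h] at h1
      rcases hcirc with hcirc | hcirc
      · rw [hcirc, e2 _ (by omega) (by omega)]
        have := a6 j hj (t - (m + 1)) (by omega) (by omega)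
        rwa [show t - (m + 1) + 1 = t - m by omega] at this
      · omega

/-! ### contraction -/

/-- contraction of an arc into its head -/
def ctr (H : V → V → Prop) (u u' : V) : V → V → Prop :=
  fun x y => x ≠ u ∧ y ≠ u ∧ (H x y ∨ (y = u' ∧ H x u))

theorem Wk_ctr {H : V → V → Prop} {u u' : V} {R : Finset V} (hu : u ∈ R) :
    ∀ {n : ℕ} {x y : V}, Wk (HR (ctr H u u') (R.erase u)) n x y →
      Wk (HR H R) n x y ∨ ∃ i j, 1 ≤ i ∧ i + j ≤ n ∧ Wk (HR H R) i x u ∧ Wk (HR H R) j u' y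
  | 0, x, y, h => .inl h
  | n + 1, x, y, ⟨z, ⟨⟨h1, h2, h3⟩, h4, h5⟩, h6⟩ => by
    have hx := Finset.mem_of_mem_erase h4
    have hz := Finset.mem_of_mem_erase h5
    have ih := Wk_ctr hu h6
    rcases h3 with h3 | ⟨rfl, h3⟩
    · rcases ih with ih | ⟨i, j, hi, hij, w1, w2⟩
      · exact .inl ⟨z, ⟨h3, hx, hz⟩, ih⟩
      · exact .inr ⟨i + 1, j, by omega, by omega, ⟨z, ⟨h3, hx, hz⟩, w1⟩, w2⟩
    · right
      rcases ih with ih | ⟨i, j, hi, hij, w1, w2⟩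
      · exact ⟨1, n, le_rfl, by omega, .one ⟨h3, hx, hu⟩, ih⟩
      · exact ⟨1, j, le_rfl, by omega, .one ⟨h3, hx, hu⟩, w2⟩

/-- lifting a path through the contraction -/
noncomputable def liftL (H : V → V → Prop) (u : V) : List V → List V
  | [] => []
  | [x] => [x]
  | x :: y :: l => if H x y then x :: liftL H u (y :: l) else x :: u :: liftL H u (y :: l)

theorem liftL_cons (H : V → V → Prop) (u x : V) (l : List V) :
    ∃ t, liftL H u (x :: l) = x :: t := by
  cases l with
  | nil => exact ⟨[], rfl⟩
  | cons y l => rw [liftL]; split_ifs <;> exact ⟨_, rfl⟩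

theorem liftL_chain {H : V → V → Prop} {u u' : V} (huu : H u u') :
    ∀ {p : List V}, List.IsChain (ctr H u u') p → List.IsChain H (liftL H u p)
  | [], _ => by simp [liftL]
  | [x], _ => by simp [liftL]
  | x :: y :: l, h => by
    rw [List.isChain_cons_cons] at h
    have ih := liftL_chain huu h.2
    obtain ⟨t, ht⟩ := liftL_cons H u y l
    rw [liftL]
    rw [ht] at ih ⊢
    split_ifs with hxy
    · exact List.isChain_cons_cons.2 ⟨hxy, ih⟩
    · obtain ⟨-, -, h1 | ⟨rfl, h1⟩⟩ := h.1
      · exact absurd h1 hxy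
      · exact List.isChain_cons_cons.2 ⟨h1, List.isChain_cons_cons.2 ⟨huu, ih⟩⟩

theorem liftL_mem {H : V → V → Prop} {u z : V} :
    ∀ {p : List V}, z ∈ liftL H u p → z ∈ p ∨ z = u
  | [], h => by simp [liftL] at h
  | [x], h => by left; simpa [liftL] using h
  | x :: y :: l, h => by
    rw [liftL] at h
    split_ifs at h
    · rcases List.mem_cons.1 h with rfl | h
      · simp
      · rcases liftL_mem h with h | h
        · left; exact List.mem_cons_of_mem _ h
        · exact .inr h
    · rcases List.mem_cons.1 h with rfl | h
      · simp
      rcases List.mem_cons.1 h with rfl | h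
      · simp
      · rcases liftL_mem h with h | h
        · left; exact List.mem_cons_of_mem _ h
        · exact .inr h

theorem liftL_getLast? {H : V → V → Prop} {u : V} :
    ∀ {p : List V}, (liftL H u p).getLast? = p.getLast?
  | [] => rfl
  | [x] => rfl
  | x :: y :: l => by
    have ih := liftL_getLast? (H := H) (u := u) (p := y :: l)
    obtain ⟨t, ht⟩ := liftL_cons H u y l
    rw [liftL]
    rw [ht] at ih ⊢
    split_ifs <;> simp [List.getLast?_cons_cons] at ih ⊢ <;> exact ih

theorem liftL_head? {H : V → V → Prop} {u : V} {p : List V} :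
    (liftL H u p).head? = p.head? := by
  cases p with
  | nil => rfl
  | cons x l => obtain ⟨t, ht⟩ := liftL_cons H u x l; rw [ht]; rfl

theorem liftL_length {H : V → V → Prop} {u : V} :
    ∀ {p : List V}, p.length ≤ (liftL H u p).length
  | [] => by simp [liftL]
  | [x] => by simp [liftL]
  | x :: y :: l => by
    have ih := liftL_length (H := H) (u := u) (p := y :: l)
    rw [liftL]
    split_ifs <;> simp at ih ⊢ <;> omega

/-- inner vertices of a lifted path -/
theorem liftL_mid {H : V → V → Prop} {u z : V} {p : List V} (hz : z ∈ (liftL H u p).tail.dropLast)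
    (hn : (liftL H u p).Nodup) : z ∈ p.tail.dropLast ∨ z = u := by
  have key : ∀ (q : List V) , q.Nodup → z ∈ q.tail.dropLast → z ∈ q ∧ q.head? ≠ some z ∧
      q.getLast? ≠ some z := by
    intro q hq hz
    cases q with
    | nil => simp at hz
    | cons x q =>
      simp at hz
      have hzq := List.mem_of_mem_dropLast hz
      refine ⟨List.mem_cons_of_mem _ hzq, ?_, ?_⟩
      · simp; rintro rfl; exact (List.nodup_cons.1 hq).1 hzq
      · have hne : q ≠ [] := by rintro rfl; simp at hzq
        intro h
        have hq2 := (List.nodup_cons.1 hq).2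
        rw [List.getLast?_cons, List.getLast?_eq_some_getLast hne] at h
        simp at h
        rw [← List.dropLast_append_getLast hne, List.nodup_append] at hq2
        exact hq2.2.2 z hz _ (by simp) h.symm
  have key2 : ∀ (q : List V), z ∈ q → q.head? ≠ some z → q.getLast? ≠ some z →
      z ∈ q.tail.dropLast := by
    intro q h1 h2 h3
    cases q with
    | nil => simp at h1
    | cons x q =>
      simp at h2 ⊢
      have hzq : z ∈ q := by
        rcases List.mem_cons.1 h1 with rfl | h
        · exact absurd rfl h2
        · exact h
      have hne : q ≠ [] := by rintro rfl; simp at hzq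
      rw [List.getLast?_cons, List.getLast?_eq_some_getLast hne] at h3
      rw [← List.dropLast_append_getLast hne] at hzq
      rcases List.mem_append.1 hzq with h | h
      · exact h
      · simp at h h3; exact absurd h.symm h3
  obtain ⟨h1, h2, h3⟩ := key _ hn hz
  rcases liftL_mem h1 with h | h
  · left
    rw [liftL_head?] at h2; rw [liftL_getLast?] at h3
    exact key2 p h h2 h3
  · exact .inr h

/-- `p` uses a contracted arc -/
def via (H : V → V → Prop) (p : List V) : Prop := ∃ s w z t, p = s ++ w :: z :: t ∧ ¬ H w z

theorem liftL_u {H : V → V → Prop} {u : V} : ∀ {p : List V}, u ∉ p → u ∈ liftL H u p → via H p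
  | [], _, h => by simp [liftL] at h
  | [x], h1, h => by simp [liftL] at h; simp [h] at h1
  | x :: y :: l, h1, h => by
    rw [liftL] at h
    split_ifs at h with hxy
    · rcases List.mem_cons.1 h with rfl | h
      · simp at h1
      · obtain ⟨s, w, z, t, e, h2⟩ := liftL_u (fun h' => h1 (List.mem_cons_of_mem _ h')) h
        exact ⟨x :: s, w, z, t, by rw [e]; rfl, h2⟩
    · exact ⟨[], x, y, l, rfl, hxy⟩

theorem via_end {H : V → V → Prop} {u u' : V} {p : List V} (hc : List.IsChain (ctr H u u') p)
    (hv : via H p) : ∃ s w t, p = s ++ w :: u' :: t ∧ ¬ H w u' ∧ H w u := by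
  obtain ⟨s, w, z, t, e, h⟩ := hv
  rw [e] at hc
  have := (List.isChain_append.1 hc).2.1
  rw [List.isChain_cons_cons] at this
  obtain ⟨-, -, h1 | ⟨rfl, h1⟩⟩ := this.1
  · exact absurd h1 h
  · exact ⟨s, w, t, e, h, h1⟩

theorem liftL_nodup {H : V → V → Prop} {u u' : V} :
    ∀ {p : List V}, u ∉ p → List.IsChain (ctr H u u') p → p.Nodup → (liftL H u p).Nodup
  | [], _, _, _ => by simp [liftL]
  | [x], _, _, _ => by simp [liftL]
  | x :: y :: l, hu, hc, hn => by
    have hc' := List.isChain_cons_cons.1 hc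
    have hu' : u ∉ y :: l := fun h' => hu (List.mem_cons_of_mem _ h')
    have hn' := List.nodup_cons.1 hn
    have ih := liftL_nodup hu' hc'.2 hn'.2
    have hx : x ∉ liftL H u (y :: l) := by
      intro h
      rcases liftL_mem h with h | h
      · exact hn'.1 h
      · simp [h] at hu
    rw [liftL]
    split_ifs with hxy
    · exact List.nodup_cons.2 ⟨hx, ih⟩
    · refine List.nodup_cons.2 ⟨?_, List.nodup_cons.2 ⟨?_, ih⟩⟩
      · intro h
        rcases List.mem_cons.1 h with rfl | h
        · simp at hu
        · exact hx h
      · intro h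
        obtain ⟨s, w, t, e, h1, h2⟩ := via_end hc'.2 (liftL_u hu' h)
        have hy : y = u' := by
          obtain ⟨-, -, h1 | ⟨rfl, h1⟩⟩ := hc'.1
          · exact absurd h1 hxy
          · rfl
        subst hy
        have hn2 := hn'.2
        rw [e, List.nodup_append] at hn2
        cases s with
        | nil =>
          simp at e
          simp [e] at hn2
        | cons s0 s =>
          simp at e
          exact hn2.2.2 s0 (by simp) y (by simp) e.1.symm

end Paper

namespace Paper
open Classical
variable {V : Type}

theorem not_mem_ctr {H : V → V → Prop} {u u' : V} : ∀ {p : List V},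
    List.IsChain (ctr H u u') p → 2 ≤ p.length → u ∉ p
  | [], _, h => by simp at h
  | [x], _, h => by simp at h
  | [x, y], h, _ => by
    rw [List.isChain_cons_cons] at h
    intro hm
    simp at hm
    rcases hm with rfl | rfl
    · exact h.1.1 rfl
    · exact h.1.2.1 rfl
  | x :: y :: z :: l, h, _ => by
    rw [List.isChain_cons_cons] at h
    have := not_mem_ctr h.2 (by simp)
    intro hm
    rcases List.mem_cons.1 hm with rfl | hm
    · exact h.1.1 rfl
    · exact this hm

theorem chain_of_ctr {H : V → V → Prop} {u u' : V} {p : List V}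
    (hc : List.IsChain (ctr H u u') p) (hu : u' ∉ p) : List.IsChain H p := by
  induction p with
  | nil => simp
  | cons x p ih =>
    cases p with
    | nil => simp
    | cons y p =>
      rw [List.isChain_cons_cons] at hc ⊢
      refine ⟨?_, ih hc.2 (fun h => hu (List.mem_cons_of_mem _ h))⟩
      obtain ⟨-, -, h | ⟨h, -⟩⟩ := hc.1
      · exact h
      · subst h; simp at hu

theorem mem_mid {z : V} {q : List V} (h1 : z ∈ q) (h2 : q.head? ≠ some z)
    (h3 : q.getLast? ≠ some z) : z ∈ q.tail.dropLast := by
  cases q with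
  | nil => simp at h1
  | cons x q =>
    simp at h2 ⊢
    have hzq : z ∈ q := by
      rcases List.mem_cons.1 h1 with rfl | h
      · exact absurd rfl h2
      · exact h
    have hne : q ≠ [] := by rintro rfl; simp at hzq
    rw [List.getLast?_cons, List.getLast?_eq_some_getLast hne] at h3
    rw [← List.dropLast_append_getLast hne] at hzq
    rcases List.mem_append.1 hzq with h | h
    · exact h
    · simp at h h3; exact absurd h.symm h3

theorem mid_mem {z : V} {q : List V} (h : z ∈ q.tail.dropLast) : z ∈ q :=
  List.mem_of_mem_tail (List.mem_of_mem_dropLast h)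

theorem lift_sub {W : Type} {F : W → W → Prop} (hiso : ∀ w, ∃ y, F w y ∨ F y w)
    (hin : ∀ x x' y, F x y → F x' y → x ≠ x' → (∀ z, ¬ F y z) ∧
      ∀ x'', F x'' y → x'' = x ∨ x'' = x')
    {H : V → V → Prop} {u u' : V} (huu : H u u') (hne : u ≠ u')
    (h : ContainsSubdivisionOf (ctr H u u') F) : ContainsSubdivisionOf H F := by
  obtain ⟨φ, P, hφ, hP, hD⟩ := h
  have hc : ∀ x y, F x y → List.IsChain (ctr H u u') (P x y) := fun x y h => (hP h).1.2.2
  have hn : ∀ x y, F x y → (P x y).Nodup := fun x y h => (hP h).1.2.1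
  have hu : ∀ x y, F x y → u ∉ P x y := fun x y h => not_mem_ctr (hc x y h) (hP h).2.2.2.1
  have hφu : ∀ w, φ w ≠ u := by
    intro w e
    obtain ⟨y, h | h⟩ := hiso w
    · exact hu _ _ h (e ▸ List.mem_of_mem_head? (hP h).2.1)
    · exact hu _ _ h (e ▸ List.mem_of_getLast? (hP h).2.2.1)
  by_cases hv : ∃ x y x' y', F x y ∧ F x' y' ∧ (x, y) ≠ (x', y') ∧ via H (P x y) ∧ via H (P x' y')
  · obtain ⟨x, y, x', y', h1, h2, hxy, v1, v2⟩ := hv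
    have main : ∀ x y x' y', F x y → F x' y' → (x, y) ≠ (x', y') → via H (P x y) →
        via H (P x' y') → ∃ s w, P x y = s ++ [w] ++ [u'] ∧ H w u ∧ φ y = u' := by
      intro x y x' y' h1 h2 hxy v1 v2
      obtain ⟨s, w, t, e, -, hw⟩ := via_end (hc _ _ h1) v1
      obtain ⟨s', w', t', e', -, hw'⟩ := via_end (hc _ _ h2) v2
      have ht : t = [] := by
        by_contra ht
        refine hD h1 h2 hxy u' ?_ (by simp [e'])
        rw [e]
        cases s with
        | nil => simp [List.dropLast_cons_of_ne_nil ht]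
        | cons s0 s =>
          simp only [List.cons_append, List.tail_cons]
          rw [List.dropLast_append_of_ne_nil (by simp), List.dropLast_cons_of_ne_nil (by simp),
            List.dropLast_cons_of_ne_nil ht]
          simp
      subst ht
      refine ⟨s, w, by simp [e], hw, ?_⟩
      have := (hP h1).2.2.1
      rw [e] at this
      simp at this
      exact this.symm
    obtain ⟨s, w, e, hw, hy⟩ := main _ _ _ _ h1 h2 hxy v1 v2
    obtain ⟨s', w', e', hw', hy'⟩ := main _ _ _ _ h2 h1 hxy.symm v2 v1
    have : y = y' := hφ (hy.trans hy'.symm)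
    subst this
    have hxx : x ≠ x' := fun h => hxy (by rw [h])
    obtain ⟨hno, h3⟩ := hin _ _ _ h1 h2 hxx
    have hmid : ∀ x'' y'', F x'' y'' → u' ∉ (P x'' y'').tail.dropLast := by
      intro x'' y'' h hm
      by_cases hh : (x'', y'') = (x, y)
      · refine hD h h2 ?_ u' hm (by simp [e'])
        rw [hh]; exact hxy
      · exact hD h h1 hh u' hm (by simp [e])
    have hcon : ∀ x'' y'', F x'' y'' → u' ∈ P x'' y'' →
        ∃ s w, P x'' y'' = s ++ [w] ++ [u'] ∧ H w u := by
      intro x'' y'' h hm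
      have hl : (P x'' y'').getLast? = some u' := by
        by_contra hl
        refine hmid _ _ h (mem_mid hm ?_ hl)
        rw [(hP h).2.1]
        simp
        rw [← hy]
        intro hh
        have := hφ hh
        subst this
        exact hno _ h
      rw [(hP h).2.2.1] at hl
      simp at hl
      have := hφ (hl.trans hy.symm)
      subst this
      rcases h3 _ h with rfl | rfl
      · exact ⟨s, w, e, hw⟩
      · exact ⟨s', w', e', hw'⟩
    let f : V → V := fun z => if z = u' then u else z
    have f1 : f u' = u := if_pos rfl
    have f2 : ∀ z, z ≠ u' → f z = z := fun z hz => if_neg hz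
    have finj : ∀ z z', z ≠ u → z' ≠ u → f z = f z' → z = z' := by
      intro z z' hz hz' h
      simp only [f] at h
      split_ifs at h with c1 c2 c2
      · rw [c1, c2]
      · exact absurd h.symm hz'
      · exact absurd h hz
      · exact h
    have mapid : ∀ l : List V, u' ∉ l → l.map f = l := by
      intro l hl
      conv_rhs => rw [← List.map_id l]
      exact List.map_congr_left (fun z hz => f2 z (by rintro rfl; exact hl hz))
    refine ⟨f ∘ φ, fun x y => (P x y).map f, ?_, ?_, ?_⟩
    · intro z z' h
      exact hφ (finj _ _ (hφu _) (hφu _) h)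
    · intro p q h
      have hmid' : ∀ z ∈ ((P p q).map f).tail.dropLast, z ∈ (P p q).tail.dropLast := by
        intro z hz
        rw [← List.map_tail, ← List.map_dropLast, mapid _ (hmid _ _ h)] at hz
        exact hz
      refine ⟨⟨?_, ?_, ?_⟩, ?_, ?_, ?_, ?_⟩
      · simpa using (hP h).1.1
      · refine List.Nodup.map_on ?_ (hn _ _ h)
        intro z hz z' hz'
        exact finj _ _ (fun hh => hu _ _ h (hh ▸ hz)) (fun hh => hu _ _ h (hh ▸ hz'))
      · show List.IsChain H ((P p q).map f)
        by_cases hm : u' ∈ P p q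
        · obtain ⟨s, w, e, hw⟩ := hcon _ _ h hm
          have hn' := hn _ _ h
          have hc' := hc _ _ h
          rw [e] at hn' hc' ⊢
          have hu' : u' ∉ s ++ [w] := by
            intro hh
            exact (List.nodup_append.1 hn').2.2 _ hh _ (by simp) rfl
          rw [List.map_append, mapid _ hu']
          simp only [List.map_cons, List.map_nil, f1]
          rw [List.isChain_append] at hc' ⊢
          refine ⟨chain_of_ctr hc'.1 hu', by simp, ?_⟩
          intro a ha c hc
          simp at ha hc
          subst ha; subst hc; exact hw
        · rw [mapid _ hm]
          exact chain_of_ctr (hc _ _ h) hm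
      · simp [(hP h).2.1]
      · simp [(hP h).2.2.1]
      · simpa using (hP h).2.2.2.1
      · intro z hz w hw
        have hz' := hmid' z hz
        have hzu : z ≠ u' := fun hh => hmid _ _ h (hh ▸ hz')
        rw [← f2 z hzu] at hw
        have := finj _ _ (hφu _) (fun hh => hu _ _ h (hh ▸ mid_mem hz')) hw
        exact (hP h).2.2.2.2 z hz' w this
    · intro p q p' q' h h' hpq z hz hz2
      have hmid' : z ∈ (P p q).tail.dropLast := by
        rw [← List.map_tail, ← List.map_dropLast, mapid _ (hmid _ _ h)] at hz
        exact hz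
      have hzu : z ≠ u' := fun hh => hmid _ _ h (hh ▸ hmid')
      obtain ⟨z1, hz1, e1⟩ := List.mem_map.1 hz2
      rw [← f2 z hzu] at e1
      have := finj _ _ (fun hh => hu _ _ h' (hh ▸ hz1))
        (fun hh => hu _ _ h (hh ▸ mid_mem hmid')) e1
      subst this
      exact hD h h' hpq _ hmid' hz1
  · push Not at hv
    have hn' : ∀ x y, F x y → (liftL H u (P x y)).Nodup := fun x y h =>
      liftL_nodup (hu x y h) (hc x y h) (hn x y h)
    refine ⟨φ, fun x y => liftL H u (P x y), hφ, ?_, ?_⟩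
    · intro x y h
      refine ⟨⟨?_, hn' x y h, liftL_chain huu (hc x y h)⟩, ?_, ?_, ?_, ?_⟩
      · intro hh
        have := liftL_length (H := H) (u := u) (p := P x y)
        have := (hP h).2.2.2.1
        rw [show liftL H u (P x y) = [] from hh, List.length_nil] at *
        omega
      · rw [liftL_head?]; exact (hP h).2.1
      · rw [liftL_getLast?]; exact (hP h).2.2.1
      · exact (hP h).2.2.2.1.trans liftL_length
      · intro z hz w
        rcases liftL_mid hz (hn' x y h) with hz | rfl
        · exact (hP h).2.2.2.2 z hz w
        · exact hφu w
    · intro x y x' y' h h' hxy z hz hz2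
      rcases liftL_mid hz (hn' x y h) with hz1 | rfl
      · rcases liftL_mem hz2 with hz2 | rfl
        · exact hD h h' hxy z hz1 hz2
        · exact hu _ _ h (mid_mem hz1)
      · exact hv x y x' y' h h' hxy (liftL_u (hu _ _ h) (mid_mem hz)) (liftL_u (hu _ _ h') hz2)

theorem lift_Cab {a b : ℕ} (ha : 2 ≤ a) (hb : 1 ≤ b)
    {H : V → V → Prop} {u u' : V} (huu : H u u') (hne : u ≠ u')
    (h : ContainsSubdivisionOf (ctr H u u') (Cab a b)) : ContainsSubdivisionOf H (Cab a b) := by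
  refine lift_sub ?_ ?_ huu hne h
  · intro w
    refine ⟨w + 1, ?_⟩
    rw [Cab_iff ha hb, Cab_iff ha hb]
    rcases Nat.mod_two_eq_zero_or_one (w.val / b) with h | h
    · left; left; exact ⟨rfl, h⟩
    · right; right; exact ⟨rfl, h⟩
  · intro x x' y h1 h2 hne
    have aux : ∀ x x' y : ZMod (2 * a * b), (y = x + 1 ∧ (x.val / b) % 2 = 0) →
        (x' = y + 1 ∧ (y.val / b) % 2 = 1) → (∀ z, ¬ Cab a b y z) ∧
        ∀ x'', Cab a b x'' y → x'' = x ∨ x'' = x' := by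
      rintro x x' y ⟨h1, h2⟩ ⟨h3, h4⟩
      refine ⟨fun z hz => ?_, fun x'' hx => ?_⟩
      · rw [Cab_iff ha hb] at hz
        rcases hz with ⟨h5, h6⟩ | ⟨h5, h6⟩
        · omega
        · have : z = x := add_right_cancel (h5.symm.trans h1)
          subst this; omega
      · rw [Cab_iff ha hb] at hx
        rcases hx with ⟨h5, h6⟩ | ⟨h5, h6⟩
        · left; exact add_right_cancel (h5.symm.trans h1)
        · right; rw [h5, h3]
    rw [Cab_iff ha hb] at h1 h2
    rcases h1 with h1 | h1 <;> rcases h2 with h2 | h2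
    · exact absurd (add_right_cancel (h1.1.symm.trans h2.1)) hne
    · exact aux _ _ _ h1 h2
    · obtain ⟨h3, h4⟩ := aux _ _ _ h2 h1
      exact ⟨h3, fun x'' h => (h4 x'' h).symm⟩
    · exact absurd (h1.1.trans h2.1.symm) hne

end Paper

namespace Paper
open Classical
variable {V : Type}

theorem switch0 {H : V → V → Prop} {b : ℕ} {x e v y : V} {k m : ℕ} {l p : List V}
    (h : AP H b x (2 * k) m e l) (hm : b ≤ m) (hev : H e v) (hc : List.IsChain H (y :: p))
    (hn : (y :: p).Nodup) (hl : (y :: p).getLast (by simp) = v) (hb : b ≤ p.length)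
    (hd : ∀ z ∈ y :: p, z ∉ l) :
    ∃ l', AP H b x (2 * k + 2) 0 y l' ∧ ∀ z ∈ l', z ∈ l ∨ z ∈ y :: p := by
  obtain ⟨r, hr⟩ : ∃ r, (y :: p).reverse = v :: r := by
    refine ⟨(y :: p).dropLast.reverse, ?_⟩
    conv_lhs => rw [← List.dropLast_append_getLast (l := y :: p) (by simp), hl]
    simp
  have hlen : r.length = p.length := by
    have := congrArg List.length hr
    simp at this; omega
  have hmem : ∀ z, z ∈ v :: r ↔ z ∈ y :: p := by
    intro z; rw [← hr, List.mem_reverse]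
  have hnr : (v :: r).Nodup := by rw [← hr]; exact List.nodup_reverse.2 hn
  have hlast : (v :: r).getLast (by simp) = y := by
    have : (v :: r).getLast? = some y := by rw [← hr]; simp
    rw [List.getLast?_eq_some_getLast (by simp)] at this
    simpa using this
  have hcr : List.IsChain (dr H (2 * k + 1)) (v :: r) := by
    rw [← hr, List.isChain_reverse]
    refine hc.imp ?_
    intro a c hac
    have : (2 * k + 1) % 2 ≠ 0 := by omega
    simp only [dr, flip, this, if_false]; exact hac
  have s1 : AP H b x (2 * k) (m + 1) v (v :: l) :=
    .step h (hd v ((hmem v).1 (by simp))) (by simpa [dr] using hev)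
  have s2 := AP.turn s1 (by omega)
  have s3 := s2.append r hcr (List.nodup_cons.1 hnr).2 (by
    intro z hz hz'
    rcases List.mem_cons.1 hz' with rfl | hz'
    · exact (List.nodup_cons.1 hnr).1 hz
    · exact hd z ((hmem z).1 (List.mem_cons_of_mem _ hz)) hz')
  rw [hlast] at s3
  refine ⟨_, AP.turn s3 (by omega), ?_⟩
  intro z hz
  rcases List.mem_append.1 hz with hz | hz
  · right; rw [← hmem]; exact List.mem_cons_of_mem _ (List.mem_reverse.1 hz)
  · rcases List.mem_cons.1 hz with rfl | hz
    · right; rw [← hmem]; simp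
    · exact .inl hz

theorem chain_HR_mem {H : V → V → Prop} {R : Finset V} {x : V} {p : List V} (hx : x ∈ R)
    (h : List.IsChain (HR H R) (x :: p)) : ∀ z ∈ x :: p, z ∈ R := by
  induction p generalizing x with
  | nil => simpa using hx
  | cons y p ih =>
    rw [List.isChain_cons_cons] at h
    intro z hz
    rcases List.mem_cons.1 hz with rfl | hz
    · exact hx
    · exact ih h.1.2.2 h.2 z hz

theorem gadget {H : V → V → Prop} {R : Finset V} {b : ℕ} (hb : 1 ≤ b)
    (hg : ∀ n x, 0 < n → n ≤ b → ¬ Wk (HR H R) n x x) {v q : V} (hv : v ∈ R) (hq : q ∈ R)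
    (hvq : H v q)
    (harc : ∀ u ∈ R, ∀ u' ∈ R, H u u' → (∃ n ≤ b, Wk (HR H R) n u' u) ∨
      ∃ w ∈ R, H w u ∧ H w u') :
    ∃ G : Finset V, G ⊆ R ∧ G.card ≤ 2 * b + 2 ∧ v ∈ G ∧ q ∈ G ∧
      (∀ x ∈ G, ∃ m l, AP H b x 0 m q l ∧ ∀ z ∈ l, z ∈ G) ∧
      ∀ x k m e l, AP H b x (2 * k) m e l → b ≤ m → H e v → (∀ z ∈ l, z ∉ G) →
        ∃ m' l', AP H b x (2 * k + 2) m' q l' ∧ ∀ z ∈ l', z ∈ l ∨ z ∈ G := by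
  have hloop : ∀ z ∈ R, ¬ H z z := fun z hz h => hg 1 z (by omega) hb (.one ⟨h, hz, hz⟩)
  have hHR : ∀ l, List.IsChain (HR H R) l → List.IsChain H l := fun l h =>
    h.imp (fun _ _ h => h.1)
  have iter : ∀ i ≤ b, (∃ n ≤ 2 * b, Wk (HR H R) n q v) ∨ ∃ p x, List.IsChain (HR H R) (x :: p) ∧
      (x :: p).getLast (by simp) = v ∧ p.length = i ∧ ∀ z ∈ x :: p, z ∈ R ∧ H z q := by
    intro i
    induction i with
    | zero =>
      intro _
      right
      exact ⟨[], v, by simp, by simp, rfl, by simp [hv, hvq]⟩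
    | succ i ih =>
      intro hi
      rcases ih (by omega) with h | ⟨p, x, h1, h2, h3, h4⟩
      · exact .inl h
      · have hx := h4 x (by simp)
        rcases harc x hx.1 q hq hx.2 with ⟨n, hn, w⟩ | ⟨w, hw, hwx, hwq⟩
        · left
          have := w.trans (Wk.ofChain h1)
          rw [h2] at this
          exact ⟨_, by omega, this⟩
        · right
          refine ⟨x :: p, w, List.isChain_cons_cons.2 ⟨⟨hwx, hw, hx.1⟩, h1⟩, ?_, by simp [h3], ?_⟩
          · rw [List.getLast_cons (by simp)]; exact h2
          · intro z hz
            rcases List.mem_cons.1 hz with rfl | hz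
            · exact ⟨hw, hwq⟩
            · exact h4 z hz
  rcases iter b le_rfl with ⟨n, hn, w⟩ | ⟨p, y, h1, h2, h3, h4⟩
  · obtain ⟨p, h1, h2, h3, h4⟩ := w.path
    have hpb : b ≤ p.length := by
      by_contra hlt
      have w' := Wk.ofChain h1
      rw [h3] at w'
      exact hg _ v (by omega) (by omega) ((Wk.one (H := HR H R) ⟨hvq, hv, hq⟩).trans w')
    have hvm : v ∈ q :: p := by rw [← h3]; exact List.getLast_mem _
    refine ⟨(q :: p).toFinset, ?_, ?_, by simpa using hvm, by simp, ?_, ?_⟩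
    · intro z hz
      exact chain_HR_mem hq h1 z (by simpa using hz)
    · refine (List.toFinset_card_le _).trans ?_
      simp; omega
    · intro x hx
      have hx : x ∈ q :: p := by simpa using hx
      by_cases hxq : x = q
      · subst hxq; exact ⟨0, [x], .nil, by simp⟩
      have hx : x ∈ p := by
        rcases List.mem_cons.1 hx with h | h
        · exact absurd h hxq
        · exact h
      obtain ⟨s, t, rfl⟩ := List.append_of_mem hx
      have c1 : List.IsChain (HR H R) (x :: t) := by
        have := (List.isChain_cons.1 h1).2
        exact (List.isChain_append.1 this).2.1
      have hl : (x :: t).getLast (by simp) = v := by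
        have e : (q :: (s ++ x :: t)).getLast? = some v := by
          rw [List.getLast?_eq_some_getLast (by simp), h3]
        rw [show q :: (s ++ x :: t) = (q :: s) ++ (x :: t) from rfl, List.getLast?_append,
          List.getLast?_eq_some_getLast (l := x :: t) (by simp)] at e
        simpa using e
      have hn2 := List.nodup_cons.1 h2
      have hn3 := (List.nodup_append.1 hn2.2).2.1
      have hqt : q ∉ t := fun h => hn2.1 (by simp [h])
      have c2 : List.IsChain (dr H 0) (x :: (t ++ [q])) := by
        have : List.IsChain H ((x :: t) ++ [q]) := by
          rw [List.isChain_append]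
          refine ⟨hHR _ c1, by simp, ?_⟩
          intro a ha c hc
          rw [List.getLast?_eq_some_getLast (by simp), hl] at ha
          simp at ha hc
          subst ha; subst hc; exact hvq
        refine List.IsChain.imp ?_ this
        intro a c h; simpa [dr] using h
      have := (AP.nil (H := H) (b := b) (x := x)).append (t ++ [q]) c2 (by
        have := (List.nodup_cons.1 hn3).2
        rw [List.nodup_append]
        refine ⟨this, by simp, ?_⟩
        intro a ha c hc
        simp at hc; subst hc
        rintro rfl; exact hqt ha) (by
        intro z hz hzx
        simp at hzx; subst hzx
        rcases List.mem_append.1 hz with hz | hz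
        · exact (List.nodup_cons.1 hn3).1 hz
        · simp at hz; exact hxq hz)
      have hl2 : (x :: (t ++ [q])).getLast (by simp) = q := by
        simp
      rw [hl2] at this
      refine ⟨_, _, this, ?_⟩
      intro z hz
      simp at hz ⊢
      tauto
    · intro x k m e l h hm hev hd
      obtain ⟨l', h', hl'⟩ := switch0 h hm hev (hHR _ h1) h2 h3 hpb (by
        intro z hz hz'
        exact hd z hz' (by simpa using hz))
      refine ⟨_, l', h', ?_⟩
      intro z hz
      rcases hl' z hz with h | h
      · exact .inl h
      · right; simpa using h
  · have hn := nodup_of_girth hg h1 (by simp; omega)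
    have hqc : q ∉ y :: p := fun h => hloop q hq (h4 q h).2
    refine ⟨(q :: y :: p).toFinset, ?_, ?_, ?_, by simp, ?_, ?_⟩
    · intro z hz
      rw [List.mem_toFinset] at hz
      rcases List.mem_cons.1 hz with rfl | hz
      · exact hq
      · exact (h4 z hz).1
    · refine (List.toFinset_card_le _).trans ?_
      simp; omega
    · rw [List.mem_toFinset]; right; rw [← h2]; exact List.getLast_mem _
    · intro x hx
      rw [List.mem_toFinset] at hx
      rcases List.mem_cons.1 hx with rfl | hx
      · exact ⟨0, [x], .nil, by simp⟩
      · refine ⟨_, _, .step .nil (z := q) ?_ ?_, ?_⟩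
        · simp; rintro rfl; exact hqc hx
        · simpa [dr] using (h4 x hx).2
        · intro z hz
          rw [List.mem_toFinset]
          simp at hz
          rcases hz with rfl | rfl
          · simp
          · exact List.mem_cons_of_mem _ hx
    · intro x k m e l h hm hev hd
      obtain ⟨l', h', hl'⟩ := switch0 h hm hev (hHR _ h1) hn h2 (by omega) (by
        intro z hz hz'
        exact hd z hz' (by rw [List.mem_toFinset]; exact List.mem_cons_of_mem _ hz))
      refine ⟨_, _, .step h' (z := q) ?_ ?_, ?_⟩
      · intro hh
        rcases hl' q hh with hh | hh
        · exact hd q hh (by simp)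
        · exact hqc hh
      · have : (2 * k + 2) % 2 = 0 := by omega
        simp only [dr, this, if_true]; exact (h4 y (by simp)).2
      · intro z hz
        rcases List.mem_cons.1 hz with rfl | hz
        · right; simp
        rcases hl' z hz with h | h
        · exact .inl h
        · right; rw [List.mem_toFinset]; exact List.mem_cons_of_mem _ h

end Paper

namespace Paper
open Classical
variable {V : Type}

theorem Wk.snoc {H : V → V → Prop} {n : ℕ} {x y z : V} (h : Wk H n x y) (h' : H y z) :
    Wk H (n + 1) x z := h.trans (Wk.one h')

/-- The state of the main induction. -/
structure St [Fintype V] (a b K : ℕ) (H : V → V → Prop) (X R : Finset V) (e v : V)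
    (lev : V → ℕ) : Prop where
  disj : ∀ x ∈ X, x ∉ R
  he : e ∈ X
  hv : v ∈ R
  hev : H e v
  clos : ∀ r ∈ R, ∀ y, H r y → y ∈ X ∨ y ∈ R
  deg : ∀ r ∈ R, K ≤ (Finset.univ.filter (H r)).card
  girth : ∀ n x, 0 < n → n ≤ b → ¬ Wk (HR H R) n x x
  few : ∀ j, (X.filter (fun x => lev x < j)).card ≤ (2 * b + 2) * j
  alt : ∀ x ∈ X, ∀ k m, k * (b + 1) + m ≤ lev x →
    ∃ m' l, m ≤ m' ∧ AP H b x (2 * k) m' e l ∧ ∀ z ∈ l, z ∈ X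

theorem main [Fintype V] {a b K : ℕ} (ha : 2 ≤ a) (hb : 1 ≤ b)
    (hK : (2 * b + 2) * (a * (b + 1) + b) + (2 * b + 2) + 1 ≤ K) :
    ∀ (N : ℕ) (H : V → V → Prop) (X R : Finset V) (e v : V) (lev : V → ℕ), R.card ≤ N →
      St a b K H X R e v lev → ContainsSubdivisionOf H (Cab a b) := by
  intro N
  induction N with
  | zero =>
    intro H X R e v lev hN S
    have := Finset.card_pos.2 ⟨v, S.hv⟩
    omega
  | succ N ih =>
  intro H X R e v lev hN S
  -- Step 0: reachability
  by_cases hreach : ∀ r ∈ R, ∃ n, Wk (HR H R) n v r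
  swap
  · push Not at hreach
    obtain ⟨r0, hr0, hr0'⟩ := hreach
    let R0 := R.filter (fun r => ∃ n, Wk (HR H R) n v r)
    have hsub : R0 ⊆ R := Finset.filter_subset _ _
    refine ih H X R0 e v lev ?_ ?_
    · have : R0.card < R.card := Finset.card_lt_card
        ⟨hsub, fun h => by
          obtain ⟨n, hn⟩ := (Finset.mem_filter.1 (h hr0)).2
          exact hr0' n hn⟩
      omega
    · refine ⟨fun x hx h => S.disj x hx (hsub h), S.he,
        Finset.mem_filter.2 ⟨S.hv, 0, rfl⟩, S.hev, ?_, fun r hr => S.deg r (hsub hr), ?_,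
        S.few, S.alt⟩
      · intro r hr y hy
        obtain ⟨hrR, n, hn⟩ := Finset.mem_filter.1 hr
        rcases S.clos r hrR y hy with h | h
        · exact .inl h
        · exact .inr (Finset.mem_filter.2 ⟨h, n + 1, hn.snoc ⟨hy, hrR, h⟩⟩)
      · intro n x h1 h2 h
        exact S.girth n x h1 h2 (h.mono (fun x y h => ⟨h.1, hsub h.2.1, hsub h.2.2⟩))
  -- Step 1: high level
  by_cases hhigh : ∃ w ∈ R, ∃ x ∈ X, H w x ∧ a * (b + 1) + b ≤ lev x
  · obtain ⟨w, hw, x, hx, hwx, hlev⟩ := hhigh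
    obtain ⟨m, l, hm, hap, hl⟩ := S.alt x hx a b hlev
    obtain ⟨n, hn⟩ := hreach w hw
    obtain ⟨p, h1, h2, h3, -⟩ := hn.path
    have hpR := chain_HR_mem S.hv h1
    have hc : List.IsChain (dr H (2 * a)) (e :: v :: p) := by
      have : List.IsChain H (e :: v :: p) :=
        List.isChain_cons_cons.2 ⟨S.hev, h1.imp (fun _ _ h => h.1)⟩
      refine List.IsChain.imp ?_ this
      intro y z h; simpa [dr] using h
    have := hap.append (v :: p) hc h2 (fun z hz hz' => S.disj z (hl z hz') (hpR z hz))
    rw [List.getLast_cons (by simp), h3] at this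
    exact sub_of_AP ha hb this (by omega) hwx
  push Not at hhigh
  -- Step 2: contraction
  by_cases hctr : ∀ u ∈ R, ∀ u' ∈ R, H u u' → (∃ n ≤ b, Wk (HR H R) n u' u) ∨
      ∃ w ∈ R, H w u ∧ H w u'
  swap
  · push Not at hctr
    obtain ⟨u, hu, u', hu', huu, hw1, hw2⟩ := hctr
    have hne : u ≠ u' := by
      rintro rfl
      exact S.girth 1 u (by omega) hb (.one ⟨huu, hu, hu⟩)
    have hXu : ∀ x ∈ X, x ≠ u := by rintro x hx rfl; exact S.disj x hx hu
    refine lift_Cab ha hb huu hne (ih (ctr H u u') X (R.erase u) e (if v = u then u' else v) lev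
      ?_ ?_)
    · rw [Finset.card_erase_of_mem hu]; omega
    · refine ⟨?_, S.he, ?_, ?_, ?_, ?_, ?_, S.few, ?_⟩
      · intro x hx h; exact S.disj x hx (Finset.mem_of_mem_erase h)
      · split_ifs with h
        · exact Finset.mem_erase.2 ⟨hne.symm, hu'⟩
        · exact Finset.mem_erase.2 ⟨h, S.hv⟩
      · split_ifs with h
        · exact ⟨hXu e S.he, hne.symm, .inr ⟨rfl, h ▸ S.hev⟩⟩
        · exact ⟨hXu e S.he, h, .inl S.hev⟩
      · rintro r hr y ⟨h1, h2, h3 | ⟨rfl, h3⟩⟩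
        · rcases S.clos r (Finset.mem_of_mem_erase hr) y h3 with h | h
          · exact .inl h
          · exact .inr (Finset.mem_erase.2 ⟨h2, h⟩)
        · exact .inr (Finset.mem_erase.2 ⟨h2, hu'⟩)
      · intro r hr
        obtain ⟨hru, hrR⟩ := Finset.mem_erase.1 hr
        refine (S.deg r hrR).trans ?_
        refine Finset.card_le_card_of_injOn (fun y => if y = u then u' else y) ?_ ?_
        · intro y hy
          have hy : H r y := by simpa using hy
          simp only [Finset.coe_filter, Finset.mem_univ, true_and, Set.mem_setOf_eq]
          split_ifs with h
          · exact ⟨hru, hne.symm, .inr ⟨rfl, h ▸ hy⟩⟩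
          · exact ⟨hru, h, .inl hy⟩
        · intro y hy z hz hyz
          have hy : H r y := by simpa using hy
          have hz : H r z := by simpa using hz
          simp only at hyz
          split_ifs at hyz with h1 h2 h2
          · rw [h1, h2]
          · subst h1; subst hyz; exact absurd hz (hw2 r hrR hy)
          · subst h2; subst hyz; exact absurd hy (hw2 r hrR hz)
          · exact hyz
      · intro n x h1 h2 h
        rcases Wk_ctr hu h with h | ⟨i, j, h3, h4, w1, w2⟩
        · exact S.girth n x h1 h2 h
        · exact hw1 (j + i) (by omega) (w2.trans w1)
      · intro x hx k m hkm
        obtain ⟨m', l, h1, h2, h3⟩ := S.alt x hx k m hkm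
        exact ⟨m', l, h1, h2.mono (fun y hy z hz h =>
          ⟨hXu y (h3 y hy), hXu z (h3 z hz), .inl h⟩), h3⟩
  -- Step 3: gadget
  have hout : ∀ (G : Finset V), G.card ≤ 2 * b + 2 → ∀ r ∈ R, ∃ q ∈ R, q ∉ G ∧ H r q := by
    intro G hG r hr
    by_contra hcon
    push Not at hcon
    have hsub : Finset.univ.filter (H r) ⊆
        X.filter (fun x => lev x < a * (b + 1) + b) ∪ G := by
      intro y hy
      have hy : H r y := by simpa using hy
      rw [Finset.mem_union, Finset.mem_filter]
      by_cases hyG : y ∈ G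
      · exact .inr hyG
      rcases S.clos r hr y hy with h | h
      · exact .inl ⟨h, hhigh r hr y h hy⟩
      · exact absurd hy (hcon y h hyG)
    have h1 := Finset.card_le_card hsub
    have h2 := Finset.card_union_le (X.filter (fun x => lev x < a * (b + 1) + b)) G
    have h3 := S.few (a * (b + 1) + b)
    have h4 := S.deg r hr
    omega
  obtain ⟨q, hq, -, hvq⟩ := hout ∅ (by simp) v S.hv
  obtain ⟨G, hGR, hGc, hvG, hqG, hG1, hG2⟩ := gadget hb S.girth S.hv hq hvq hctr
  obtain ⟨v', hv', hv'G, hqv'⟩ := hout G hGc q hq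
  have hXG : ∀ x ∈ X, x ∉ G := fun x hx h => S.disj x hx (hGR h)
  have hvqne : v ≠ q := by
    rintro rfl
    exact S.girth 1 v (by omega) hb (.one ⟨hvq, hq, hq⟩)
  refine ih H (X ∪ G) (R \ G) q v' (fun x => if x ∈ X then lev x + 1 else 0) ?_ ?_
  · have : (R \ G).card < R.card := Finset.card_lt_card
      ⟨Finset.sdiff_subset, fun h => (Finset.mem_sdiff.1 (h S.hv)).2 hvG⟩
    omega
  · refine ⟨?_, Finset.mem_union_right _ hqG, Finset.mem_sdiff.2 ⟨hv', hv'G⟩, hqv', ?_, ?_, ?_,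
      ?_, ?_⟩
    · intro x hx h
      rw [Finset.mem_sdiff] at h
      rcases Finset.mem_union.1 hx with hx | hx
      · exact S.disj x hx h.1
      · exact h.2 hx
    · intro r hr y hy
      rcases S.clos r (Finset.mem_sdiff.1 hr).1 y hy with h | h
      · exact .inl (Finset.mem_union_left _ h)
      · by_cases hyG : y ∈ G
        · exact .inl (Finset.mem_union_right _ hyG)
        · exact .inr (Finset.mem_sdiff.2 ⟨h, hyG⟩)
    · intro r hr; exact S.deg r (Finset.mem_sdiff.1 hr).1
    · intro n x h1 h2 h
      exact S.girth n x h1 h2 (h.mono (fun x y h => ⟨h.1, (Finset.mem_sdiff.1 h.2.1).1,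
        (Finset.mem_sdiff.1 h.2.2).1⟩))
    · intro j
      rcases j with _ | j
      · simp
      · have hsub : (X ∪ G).filter (fun x => (if x ∈ X then lev x + 1 else 0) < j + 1) ⊆
            X.filter (fun x => lev x < j) ∪ G := by
          intro x hx
          obtain ⟨hx, hx2⟩ := Finset.mem_filter.1 hx
          rw [Finset.mem_union, Finset.mem_filter]
          by_cases hxX : x ∈ X
          · rw [if_pos hxX] at hx2
            exact .inl ⟨hxX, by omega⟩
          · rcases Finset.mem_union.1 hx with h | h
            · exact absurd h hxX
            · exact .inr h
        have h1 := Finset.card_le_card hsub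
        have h2 := Finset.card_union_le (X.filter (fun x => lev x < j)) G
        have h3 := S.few j
        rw [Nat.mul_succ]
        omega
    · intro x hx k m hkm
      by_cases hxX : x ∈ X
      · simp only [if_pos hxX] at hkm
        -- direct extension
        have direct : ∀ k m, k * (b + 1) + m ≤ lev x → ∃ m' l, m + 1 ≤ m' ∧
            AP H b x (2 * k) m' q l ∧ ∀ z ∈ l, z ∈ X ∪ G := by
          intro k m h
          obtain ⟨m', l, h1, h2, h3⟩ := S.alt x hxX k m h
          have hdr : ∀ y z, H y z → dr H (2 * k) y z := by
            intro y z h; simpa [dr] using h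
          refine ⟨_, _, ?_, .step (.step h2 (z := v) ?_ (hdr _ _ S.hev)) (z := q) ?_ (hdr _ _ hvq),
            ?_⟩
          · omega
          · intro hh; exact hXG v (h3 v hh) hvG
          · intro hh
            rcases List.mem_cons.1 hh with hh | hh
            · exact hvqne hh.symm
            · exact hXG q (h3 q hh) hqG
          · intro z hz
            rw [Finset.mem_union]
            simp only [List.mem_cons] at hz
            rcases hz with rfl | rfl | hz
            · exact .inr hqG
            · exact .inr hvG
            · exact .inl (h3 z hz)
        rcases m with _ | m
        · rcases k with _ | k
          · obtain ⟨m', l, h1, h2, h3⟩ := direct 0 0 (by omega)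
            exact ⟨m', l, by omega, h2, h3⟩
          · obtain ⟨m', l, h1, h2, h3⟩ := S.alt x hxX k b (by rw [Nat.succ_mul] at hkm; omega)
            obtain ⟨m2, l2, h4, h5⟩ := hG2 x k m' e l h2 h1 S.hev (fun z hz => hXG z (h3 z hz))
            refine ⟨m2, l2, by omega, h4, ?_⟩
            intro z hz
            rw [Finset.mem_union]
            rcases h5 z hz with h | h
            · exact .inl (h3 z h)
            · exact .inr h
        · exact direct k m (by omega)
      · simp only [if_neg hxX] at hkm
        have hxG : x ∈ G := by
          rcases Finset.mem_union.1 hx with h | h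
          · exact absurd h hxX
          · exact h
        obtain ⟨m', l, h1, h2⟩ := hG1 x hxG
        have hk : k = 0 := by
          rcases k with _ | k
          · rfl
          · rw [Nat.succ_mul] at hkm; omega
        subst hk
        exact ⟨m', l, by omega, h1, fun z hz => Finset.mem_union_right _ (h2 z hz)⟩

end Paper

namespace Paper

/-- There is an absolute constant `C` such that for all `a ≥ 2`,
`b ≥ 1`, every digraph with minimum out-degree at least `C·a·b⁷` and directed girth
at least `4b²` contains a subdivision of `C_{a,b}`. -/
theorem stmt_6 :
    ∃ C : ℕ, 0 < C ∧
      ∀ a b : ℕ, 2 ≤ a → 1 ≤ b →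
        ∀ (V : Type) [Fintype V] [Nonempty V] (D : V → V → Prop),
          (∀ v, ¬ D v v) → (∀ v, C * a * b ^ 7 ≤ outDeg D v) →
          DirGirthGE D (4 * b ^ 2) →
          ContainsSubdivisionOf D (Cab a b) := by
  refine ⟨13, by norm_num, ?_⟩
  intro a b ha hb V _ _ D hirr hdeg hgirth
  classical
  have hdeg' : ∀ v, 13 * a * b ^ 7 ≤ (Finset.univ.filter (D v)).card := by
    intro v
    have := hdeg v
    rw [outDeg, Set.ncard_eq_toFinset_card'] at this
    refine this.trans (le_of_eq ?_)
    congr 1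
    ext w
    simp
  have h1 : b ^ 2 ≤ b ^ 7 := Nat.pow_le_pow_right (by omega) (by omega)
  have h2 : a * b ^ 2 ≤ a * b ^ 7 := Nat.mul_le_mul_left _ h1
  have hK : (2 * b + 2) * (a * (b + 1) + b) + (2 * b + 2) + 1 ≤ 13 * a * b ^ 7 := by
    obtain ⟨a', rfl⟩ := Nat.exists_eq_add_of_le ha
    obtain ⟨b', rfl⟩ := Nat.exists_eq_add_of_le hb
    have : (2 * (1 + b') + 2) * ((2 + a') * ((1 + b') + 1) + (1 + b')) + (2 * (1 + b') + 2) + 1 ≤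
        13 * ((2 + a') * (1 + b') ^ 2) := by
      ring_nf
      nlinarith [Nat.zero_le (a' * b'), Nat.zero_le (a' * b' ^ 2), Nat.zero_le (b' ^ 2)]
    calc _ ≤ _ := this
      _ ≤ 13 * ((2 + a') * (1 + b') ^ 7) := Nat.mul_le_mul_left _ h2
      _ = _ := by ring
  obtain ⟨e⟩ := (inferInstance : Nonempty V)
  have hpos : 0 < (Finset.univ.filter (D e)).card := by
    have := hdeg' e
    omega
  obtain ⟨v, hv⟩ := Finset.card_pos.1 hpos
  have hv : D e v := by simpa using hv
  have hve : v ≠ e := by rintro rfl; exact hirr v hv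
  have hbb : b < 4 * b ^ 2 := by nlinarith
  refine main ha hb hK _ D {e} (Finset.univ.erase e) e v (fun _ => 0) le_rfl
    ⟨?_, by simp, by simp [hve], hv, ?_, fun r _ => by convert hdeg' r, ?_, ?_, ?_⟩
  · intro x hx; simp at hx; simp [hx]
  · intro r _ y _
    by_cases h : y = e
    · left; simp [h]
    · right; simp [h]
  · intro n x h3 h4 h
    exact girth_of_dirGirth hbb hgirth n x h3 h4 (h.mono (fun _ _ h => h.1))
  · intro j
    rcases j with _ | j
    · simp
    · refine (Finset.card_filter_le _ _).trans ?_
      simp only [Finset.card_singleton]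
      nlinarith
  · intro x hx k m hkm
    have hxe : x = e := by simpa using hx
    subst hxe
    have hm : m = 0 := by omega
    have hk : k = 0 := by
      rcases k with _ | k
      · rfl
      · rw [Nat.succ_mul] at hkm; omega
    subst hm; subst hk
    exact ⟨0, [x], le_rfl, .nil, by simp⟩

end Paper
end

section
/- Let a, b ≥ 1 be integers, let 𝒞 be a chain with spine P = v_0,…,v_m and arc partition A(P) = A_1 ∪ A_2, and suppose |A_2| ≥ a(b+1) − 1. Then 𝒞 contains a strong (a,b)-alternating-path R with s_1(R) = v_0 and t_a(R) = v_m. -/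
namespace Paper

theorem adjIn_chain {V : Type*} (l : List V) : l.IsChain (adjIn l) := by
  rw [List.isChain_iff_getElem]
  intro i hi
  refine ⟨l.take i, l.drop (i + 2), ?_⟩
  rw [← List.drop_eq_getElem_cons, ← List.drop_eq_getElem_cons, List.take_append_drop]

theorem gadget_data {V : Type*} {D : V → V → Prop} {b : ℕ} (hb : 1 ≤ b)
    (G : ChainGadget D b) (hpq : G.pp ≠ G.qq) :
    ∃ (s t : V) (A B M : List V),
      (A ++ [G.qq]).IsChain G.arcs ∧ (G.pp :: B).IsChain G.arcs ∧ M.IsChain G.arcs ∧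
      (A ++ [G.qq]).Nodup ∧ (G.pp :: B).Nodup ∧ M.Nodup ∧
      (∀ x ∈ A ++ [G.qq], x ∉ G.pp :: B) ∧
      (A ++ [G.qq]).head? = some s ∧ (G.pp :: B).getLast? = some t ∧
      M.head? = some s ∧ M.getLast? = some t ∧ b + 1 ≤ M.length ∧
      (∀ x ∈ A, x ∈ G.verts) ∧ (∀ x ∈ B, x ∈ G.verts) ∧ (∀ x ∈ M, x ∈ G.verts) ∧
      (∀ x ∈ A ++ [G.qq], x ∈ M → x = s) ∧ (∀ x ∈ G.pp :: B, x ∈ M → x = t) := by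
  have hbb : b ≤ b ^ 2 := by nlinarith
  cases G with
  | I G =>
    obtain ⟨p, q, rest, nd, ch, gl⟩ := G
    simp only [ChainGadget.pp, ChainGadget.qq, ChainGadget.arcs, ChainGadget.verts,
      TypeIGadget.arcs, TypeIGadget.verts] at *
    refine ⟨q, p, [], [], q :: (rest ++ [p]), by simp, by simp, ?_, by simp, by simp, ?_, ?_,
      by simp, by simp, by simp, by rw [← List.cons_append, List.getLast?_concat], ?_, by simp,
      by simp, ?_, by simp, by simp⟩
    · exact (adjIn_chain (p :: q :: (rest ++ [p]))).tail
    · simp only [List.nodup_cons, List.nodup_append, List.mem_append, List.mem_cons] at nd ⊢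
      grind
    · simp; exact fun h => hpq h.symm
    · simp; omega
    · simp; grind
  | II G =>
    obtain ⟨p, q, r, P, ⟨hne, nd, ch⟩, hf, hl, hlen, hq, toq⟩ := G
    simp only [ChainGadget.pp, ChainGadget.qq, ChainGadget.arcs, ChainGadget.verts,
      BasicIIGadget.arcs, BasicIIGadget.verts] at *
    have hrP : r ∈ P := List.mem_of_mem_head? (by simp [hf])
    have hpP : p ∈ P := List.mem_of_mem_getLast? (by simp [hl])
    have hrp : r ≠ p := by
      rintro rfl
      match P, hf, hl, nd, hlen with
      | [x], _, _, _, hlen => rw [List.length_singleton] at hlen; omega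
      | x :: y :: l, hf, hl, nd, _ =>
        simp at hf; subst hf
        rw [List.getLast?_cons_cons] at hl
        have := List.mem_of_mem_getLast? (l := y :: l) (a := x) (by simp [hl])
        simp at nd this; grind
    refine ⟨r, p, [r], [], P, ?_, by simp, ?_, ?_, by simp, nd, ?_,
      by simp, by simp, hf, hl, ?_, ?_, by simp, ?_, ?_, by simp⟩
    · exact List.isChain_pair.2 (Or.inr ⟨hrP, rfl⟩)
    · exact (adjIn_chain P).imp (fun _ _ h => Or.inl h)
    · simp; grind
    · simp; grind
    · omega
    · simp [hrP]
    · simp; grind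
    · simp; grind
  | III G =>
    obtain ⟨p, q, r, arc, P₁, P₂, ⟨hne₁, nd₁, ch₁⟩, ⟨hne₂, nd₂, ch₂⟩, hf₁, hf₂, hl₁, hl₂,
      len₁, len₂, inter⟩ := G
    simp only [ChainGadget.pp, ChainGadget.qq, ChainGadget.arcs, ChainGadget.verts,
      TypeIIIGadget.arcs, TypeIIIGadget.verts] at *
    have hq2 : q ∈ P₂ := List.mem_of_mem_head? (by simp [hf₂])
    have hrq : r ≠ q := by
      rintro rfl
      match P₂, hf₂, hl₂, nd₂, len₂ with
      | [x], _, _, _, hlen => simp at hlen; omega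
      | x :: y :: l, hf, hl, nd, _ =>
        simp at hf; subst hf
        rw [List.getLast?_cons_cons] at hl
        have := List.mem_of_mem_getLast? (l := y :: l) (a := x) (by simp [hl])
        simp at nd this; grind
    obtain ⟨B, rfl⟩ : ∃ B, P₁ = p :: B := by
      cases P₁ with
      | nil => simp at hf₁
      | cons x l => simp at hf₁; exact ⟨l, by rw [hf₁]⟩
    refine ⟨q, r, [], B, P₂, by simp, ?_, ?_, by simp, nd₁, nd₂, ?_,
      by simp, hl₁, hf₂, hl₂, by omega, by simp, ?_, ?_, by simp, inter⟩
    · exact (adjIn_chain _).imp (fun _ _ h => Or.inr (Or.inl h))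
    · exact (adjIn_chain _).imp (fun _ _ h => Or.inr (Or.inr h))
    · intro x hx hx'
      simp at hx; subst hx
      exact hrq (inter _ hx' hq2).symm
    · intro x hx; left; simp [hx]
    · intro x hx; right; exact hx

theorem bounds_exist {m a b : ℕ} (ha : 1 ≤ a) (A : Finset (Fin m))
    (hA : a * (b + 1) - 1 ≤ A.card) :
    ∃ lo hi : ℕ → ℕ, lo 0 = 0 ∧ hi (a - 1) = m ∧ (∀ i < a, lo i + b ≤ hi i) ∧
      (∀ i, i + 1 < a → lo (i + 1) = hi i + 1) ∧
      (∀ i, i + 1 < a → ∃ h : hi i < m, (⟨hi i, h⟩ : Fin m) ∈ A) := by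
  set k := A.card with hk
  let f := A.orderEmbOfFin hk.symm
  let F : ℕ → ℕ := fun n => if h : n < k then (f ⟨n, h⟩ : ℕ) else m + (n - k)
  have hF : StrictMono F := by
    apply strictMono_nat_of_lt_succ
    intro n
    simp only [F]
    split_ifs with h1 h2 h2
    · exact f.strictMono (Fin.mk_lt_mk.2 (Nat.lt_succ_self n))
    · have := (f ⟨n, h1⟩).isLt; omega
    · omega
    · omega
  have gap : ∀ x d, F x + d ≤ F (x + d) := by
    intro x d
    induction d with
    | zero => simp
    | succ d ih => have := hF (Nat.lt_succ_self (x + d)); simp only [Nat.succ_eq_add_one] at this; grind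
  have hFk : F k = m := by simp [F]
  have hm : F (a * (b + 1) - 1) ≤ m := hFk ▸ hF.monotone hA
  let hi : ℕ → ℕ := fun i => if i + 1 < a then F ((i + 1) * (b + 1) - 1) else m
  have hhi : ∀ i < a, F ((i + 1) * (b + 1) - 1) ≤ hi i := by
    intro i h
    simp only [hi]
    split_ifs with h'
    · exact le_rfl
    · have : i + 1 = a := by omega
      rw [this]; exact hm
  refine ⟨fun i => if i = 0 then 0 else hi (i - 1) + 1, hi, by simp, ?_, ?_, ?_, ?_⟩
  · have : ¬ (a - 1 + 1 < a) := by omega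
    simp [hi, this]
  · intro i h
    have h1 := hhi i h
    rcases i with _ | i
    · have := gap 0 b
      rw [Nat.zero_add] at this
      simp at h1 ⊢; omega
    · have h2 : hi i = F ((i + 1) * (b + 1) - 1) := by simp [hi, h]
      have h3 := gap ((i + 1) * (b + 1) - 1) (b + 1)
      have h4 : (i + 1) * (b + 1) - 1 + (b + 1) = (i + 1 + 1) * (b + 1) - 1 := by
        have : 1 ≤ (i + 1) * (b + 1) := Nat.mul_pos (by omega) (by omega)
        have e : (i + 1 + 1) * (b + 1) = (i + 1) * (b + 1) + (b + 1) := by ring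
        omega
      rw [h4] at h3
      simp; omega
  · intro i h; simp
  · intro i h
    have h2 : hi i = F ((i + 1) * (b + 1) - 1) := by simp [hi, h]
    have h5 : (i + 1) * (b + 1) - 1 < k := by
      have : (i + 2) * (b + 1) ≤ a * (b + 1) := Nat.mul_le_mul_right _ (by omega)
      have e : (i + 2) * (b + 1) = (i + 1) * (b + 1) + (b + 1) := by ring
      have : 1 ≤ (i + 1) * (b + 1) := Nat.mul_pos (by omega) (by omega)
      omega
    have h6 : hi i = (f ⟨_, h5⟩ : ℕ) := by rw [h2]; simp only [F]; rw [dif_pos h5]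
    refine ⟨h6 ▸ (f _).isLt, ?_⟩
    have : (⟨hi i, h6 ▸ (f _).isLt⟩ : Fin m) = f ⟨_, h5⟩ := Fin.ext h6
    rw [this]
    exact A.orderEmbOfFin_mem hk.symm _

end Paper

namespace Paper

theorem main_aux_s10 {V : Type*} (D : V → V → Prop)
    (a b m : ℕ) (ha : 1 ≤ a) (hb : 1 ≤ b) (C : GChain D b m)
    (ha' : a - 1 < a)
    (hA2 : a * (b + 1) - 1 ≤ C.A2.card) :
    ∃ R : AltPath C.arcs a b, R.Strong ∧
      R.s ⟨0, ha⟩ = C.v 0 ∧ R.t ⟨a - 1, ha'⟩ = C.v (Fin.last m) := by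
  obtain ⟨lo, hi, hlo0, hhia, hlen, hstep, hmem⟩ := bounds_exist ha C.A2 hA2
  -- the spine as a function on naturals
  let w : ℕ → V := fun n => C.v ⟨min n m, by omega⟩
  have hw : ∀ n (h : n < m + 1), w n = C.v ⟨n, h⟩ := by
    intro n h; simp only [w]; congr 2; omega
  have winj : ∀ x y, x ≤ m → y ≤ m → w x = w y → x = y := by
    intro x y hx hy h
    rw [hw x (by omega), hw y (by omega)] at h
    simpa using C.inj h
  have warc : ∀ n, n < m → C.arcs (w n) (w (n + 1)) := by
    intro n h
    left
    refine ⟨⟨n, h⟩, ?_, ?_⟩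
    · rw [hw n (by omega)]; rfl
    · rw [hw (n + 1) (by omega)]; rfl
  have hwm : w m = C.v (Fin.last m) := hw m (by omega)
  have hw0 : w 0 = C.v 0 := hw 0 (by omega)
  -- monotonicity of the bounds
  have hilt : ∀ i, i + 1 < a → hi i < m := fun i h => (hmem i h).1
  have hile : ∀ i, i < a → hi i ≤ m := by
    intro i h
    by_cases h' : i + 1 < a
    · exact (hilt i h').le
    · have : i = a - 1 := by omega
      rw [this, hhia]
  have hmono : ∀ i j, i < j → j < a → hi i < lo j := by
    intro i j hij
    induction j with
    | zero => omega
    | succ j ih =>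
      intro hj
      rw [hstep j hj]
      rcases Nat.lt_succ_iff_lt_or_eq.1 hij with h | h
      · have := ih h (by omega)
        have := hlen j (by omega)
        omega
      · rw [h]; omega
  have hiinj : ∀ i j, i < a → j < a → hi i = hi j → i = j := by
    intro i j h1 h2 h
    rcases lt_trichotomy i j with h' | h' | h'
    · have := hmono i j h' h2; have := hlen j h2; omega
    · exact h'
    · have := hmono j i h' h1; have := hlen i h1; omega
  -- vertex sets of the gadgets used
  let W : ℕ → Set V := fun i => {x | ∃ h : i + 1 < a, x ∈ (C.gad _ (hmem i h).2).verts}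
  have hWsp : ∀ i, i + 1 < a → ∀ n ≤ m, w n ∈ W i → n = hi i ∨ n = hi i + 1 := by
    rintro i h n hn ⟨_, hx⟩
    rw [hw n (by omega)] at hx
    have := C.hspine _ _ _ hx
    simpa [Fin.ext_iff] using this
  have hWW : ∀ i j, i ≠ j → ∀ x ∈ W i, x ∈ W j → ∃ n ≤ m, x = w n := by
    rintro i j hij x ⟨h1, hx1⟩ ⟨h2, hx2⟩
    obtain ⟨k, hk⟩ := C.hdisj _ _ _ _ (by
      intro h
      rw [Fin.mk.injEq] at h
      exact hij (hiinj i j (by omega) (by omega) h)) x hx1 hx2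
    exact ⟨k, by omega, by rw [hk, hw k k.isLt]⟩
  -- the data extracted from the gadgets
  have hdata : ∀ i, ∃ (s t : V) (A B M : List V), i + 1 < a →
      ((A ++ [w (hi i + 1)]).IsChain C.arcs ∧ (w (hi i) :: B).IsChain C.arcs ∧
      M.IsChain C.arcs ∧
      (A ++ [w (hi i + 1)]).Nodup ∧ (w (hi i) :: B).Nodup ∧ M.Nodup ∧
      (∀ x ∈ A ++ [w (hi i + 1)], x ∉ w (hi i) :: B) ∧
      (A ++ [w (hi i + 1)]).head? = some s ∧ (w (hi i) :: B).getLast? = some t ∧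
      M.head? = some s ∧ M.getLast? = some t ∧ b + 1 ≤ M.length ∧
      (∀ x ∈ A, x ∈ W i) ∧ (∀ x ∈ B, x ∈ W i) ∧ (∀ x ∈ M, x ∈ W i) ∧
      (∀ x ∈ A ++ [w (hi i + 1)], x ∈ M → x = s) ∧ (∀ x ∈ w (hi i) :: B, x ∈ M → x = t)) := by
    intro i
    by_cases h : i + 1 < a
    · have hp : (C.gad _ (hmem i h).2).pp = w (hi i) := by
        rw [C.hp, hw (hi i) (by have := hilt i h; omega)]; rfl
      have hq : (C.gad _ (hmem i h).2).qq = w (hi i + 1) := by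
        rw [C.hq, hw (hi i + 1) (by have := hilt i h; omega)]; rfl
      have hne : (C.gad _ (hmem i h).2).pp ≠ (C.gad _ (hmem i h).2).qq := by
        rw [hp, hq]
        intro h'
        have := hilt i h
        have := winj _ _ (by omega) (by omega) h'
        omega
      obtain ⟨s, t, A, B, M, c1, c2, c3, n1, n2, n3, d, h1, h2, h3, h4, l, v1, v2, v3, x1, x2⟩ :=
        gadget_data hb _ hne
      rw [hp] at c2 n2 d h2 x2
      rw [hq] at c1 n1 d h1 x1
      have harc : ∀ x y, (C.gad _ (hmem i h).2).arcs x y → C.arcs x y :=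
        fun x y hxy => Or.inr ⟨_, _, hxy⟩
      exact ⟨s, t, A, B, M, fun _ => ⟨c1.imp harc, c2.imp harc, c3.imp harc, n1, n2, n3, d, h1, h2,
        h3, h4, l, fun x hx => ⟨h, v1 x hx⟩, fun x hx => ⟨h, v2 x hx⟩, fun x hx => ⟨h, v3 x hx⟩,
        x1, x2⟩⟩
    · exact ⟨w 0, w 0, [], [], [], fun h' => absurd h' h⟩
  choose sg tg A0 B0 M hd using hdata
  -- pieces attached to the i-th forward path
  let A : ℕ → List V := fun i => if i = 0 then [] else A0 (i - 1)
  let B : ℕ → List V := fun i => if i + 1 < a then B0 i else []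
  let s : ℕ → V := fun i => if i = 0 then w 0 else sg (i - 1)
  let t : ℕ → V := fun i => if i + 1 < a then tg i else w m
  let S : ℕ → List V := fun i => (List.range' (lo i) (hi i - lo i + 1)).map w
  have memS : ∀ i, i < a → ∀ x, x ∈ S i ↔ ∃ n, lo i ≤ n ∧ n ≤ hi i ∧ x = w n := by
    intro i h x
    have := hlen i h
    simp only [S, List.mem_map, List.mem_range'_1]
    constructor
    · rintro ⟨n, h1, rfl⟩; exact ⟨n, by omega, by omega, rfl⟩
    · rintro ⟨n, h1, h2, rfl⟩; exact ⟨n, by omega, rfl⟩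
  have Sne : ∀ i, S i ≠ [] := by intro i; simp [S]
  have Shead : ∀ i, (S i).head? = some (w (lo i)) := by
    intro i; simp [S, List.head?_range']
  have Slast : ∀ i, i < a → (S i).getLast? = some (w (hi i)) := by
    intro i h
    have := hlen i h
    simp [S, List.getLast?_range']
    congr 1; omega
  have Snd : ∀ i, i < a → (S i).Nodup := by
    intro i h
    refine List.Nodup.map_on ?_ List.nodup_range'
    intro x hx y hy hxy
    rw [List.mem_range'_1] at hx hy
    have := hlen i h
    have := hile i h
    exact winj x y (by omega) (by omega) hxy
  have Sch : ∀ i, i < a → (S i).IsChain C.arcs := by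
    intro i h
    rw [List.isChain_iff_getElem]
    intro n hn
    simp only [S, List.length_map, List.length_range'] at hn
    simp only [S, List.getElem_map, List.getElem_range']
    have := hlen i h
    have := hile i h
    have e : lo i + 1 * (n + 1) = lo i + 1 * n + 1 := by ring
    rw [e]
    apply warc; omega
  have Slen : ∀ i, i < a → b + 1 ≤ (S i).length := by
    intro i h
    have := hlen i h
    simp only [S, List.length_map, List.length_range']; omega
  -- properties of A and B
  have hA : ∀ i, i < a → (A i ++ [w (lo i)]).IsChain C.arcs ∧ (A i ++ [w (lo i)]).Nodup ∧
      (A i ++ [w (lo i)]).head? = some (s i) := by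
    intro i h
    rcases i with _ | i
    · simp [A, s, hlo0]
    · obtain ⟨c1, c2, c3, n1, n2, n3, d, h1, h2, h3, h4, l, v1, v2, v3, x1, x2⟩ := hd i h
      simp only [A, s, Nat.add_eq_zero_iff, one_ne_zero, and_false, if_false, Nat.add_sub_cancel, hstep i h]
      exact ⟨c1, n1, h1⟩
  have hB : ∀ i, i < a → (w (hi i) :: B i).IsChain C.arcs ∧ (w (hi i) :: B i).Nodup ∧
      (w (hi i) :: B i).getLast? = some (t i) := by
    intro i h
    by_cases h' : i + 1 < a
    · obtain ⟨c1, c2, c3, n1, n2, n3, d, h1, h2, h3, h4, l, v1, v2, v3, x1, x2⟩ := hd i h'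
      simp only [B, t, h', if_true]
      exact ⟨c2, n2, h2⟩
    · have : i = a - 1 := by omega
      have e : hi i = m := by rw [this, hhia]
      simp [B, t, h', e]
  have Amem : ∀ i, i < a → ∀ x ∈ A i, ∃ j, i = j + 1 ∧ x ∈ A0 j ∧ x ∈ W j := by
    intro i h x hx
    rcases i with _ | i
    · simp [A] at hx
    · obtain ⟨c1, c2, c3, n1, n2, n3, d, h1, h2, h3, h4, l, v1, v2, v3, x1, x2⟩ := hd i h
      simp [A] at hx
      exact ⟨i, rfl, hx, v1 x hx⟩
  have Bmem : ∀ i, i < a → ∀ x ∈ B i, i + 1 < a ∧ x ∈ B0 i ∧ x ∈ W i := by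
    intro i h x hx
    by_cases h' : i + 1 < a
    · obtain ⟨c1, c2, c3, n1, n2, n3, d, h1, h2, h3, h4, l, v1, v2, v3, x1, x2⟩ := hd i h'
      simp [B, h'] at hx
      exact ⟨h', hx, v2 x hx⟩
    · simp [B, h'] at hx
  have A0sp : ∀ j, j + 1 < a → ∀ x ∈ A0 j, ∀ n ≤ m, x ≠ w n := by
    rintro j hj x hx n hn rfl
    obtain ⟨c1, c2, c3, n1, n2, n3, d, h1, h2, h3, h4, l, v1, v2, v3, x1, x2⟩ := hd j hj
    rcases hWsp j hj n hn (v1 _ hx) with h | h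
    · subst h; exact d _ (List.mem_append_left _ hx) (by simp)
    · subst h
      rw [List.nodup_append] at n1
      exact n1.2.2 _ hx _ (by simp) rfl
  have B0sp : ∀ j, j + 1 < a → ∀ x ∈ B0 j, ∀ n ≤ m, x ≠ w n := by
    rintro j hj x hx n hn rfl
    obtain ⟨c1, c2, c3, n1, n2, n3, d, h1, h2, h3, h4, l, v1, v2, v3, x1, x2⟩ := hd j hj
    rcases hWsp j hj n hn (v2 _ hx) with h | h
    · subst h; simp [hx] at n2
    · subst h; exact d _ (by simp) (List.mem_cons_of_mem _ hx)
  let Q : ℕ → List V := fun i => A i ++ S i ++ B i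
  -- classification of membership
  have Qmem : ∀ i, i < a → ∀ x ∈ Q i,
      (∃ j, i = j + 1 ∧ x ∈ A0 j ∧ x ∈ W j ∧ ∀ n ≤ m, x ≠ w n) ∨
      (∃ n, lo i ≤ n ∧ n ≤ hi i ∧ n ≤ m ∧ x = w n) ∨
      (i + 1 < a ∧ x ∈ B0 i ∧ x ∈ W i ∧ ∀ n ≤ m, x ≠ w n) := by
    intro i h x hx
    simp only [Q, List.mem_append] at hx
    rcases hx with (hx | hx) | hx
    · obtain ⟨j, rfl, h1, h2⟩ := Amem i h x hx
      exact Or.inl ⟨j, rfl, h1, h2, A0sp j h x h1⟩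
    · obtain ⟨n, h1, h2, h3⟩ := (memS i h x).1 hx
      exact Or.inr (Or.inl ⟨n, h1, h2, h2.trans (hile i h), h3⟩)
    · obtain ⟨h1, h2, h3⟩ := Bmem i h x hx
      exact Or.inr (Or.inr ⟨h1, h2, h3, B0sp i h1 x h2⟩)
  have hAB0 : ∀ j, j + 1 < a → ∀ x ∈ A0 j, x ∉ B0 j := by
    intro j hj x hx hx'
    obtain ⟨c1, c2, c3, n1, n2, n3, d, -⟩ := hd j hj
    exact d x (List.mem_append_left _ hx) (List.mem_cons_of_mem _ hx')
  have QQ : ∀ i j, i < a → j < a → i ≠ j → ∀ x ∈ Q i, x ∉ Q j := by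
    intro i j hi' hj' hij x hx hy
    rcases Qmem i hi' x hx with ⟨k, rfl, h1, h2, h3⟩ | ⟨n, h1, h2, h3, h4⟩ | ⟨h0, h1, h2, h3⟩ <;>
    rcases Qmem j hj' x hy with ⟨k', rfl, h1', h2', h3'⟩ | ⟨n', h1', h2', h3', h4'⟩ | ⟨h0', h1', h2', h3'⟩
    · obtain ⟨n, hn, e⟩ := hWW k k' (by omega) x h2 h2'; exact h3 n hn e
    · exact h3 n' h3' h4'
    · by_cases e : k = j
      · subst e; exact hAB0 k hi' x h1 h1'
      · obtain ⟨n, hn, e⟩ := hWW k j e x h2 h2'; exact h3 n hn e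
    · exact h3' n h3 h4
    · have := winj n n' h3 h3' (h4.symm.trans h4')
      subst this
      rcases lt_or_gt_of_ne hij with h | h
      · have := hmono i j h hj'; omega
      · have := hmono j i h hi'; omega
    · exact h3' n h3 h4
    · by_cases e : i = k'
      · subst e; exact hAB0 i hj' x h1' h1
      · obtain ⟨n, hn, e⟩ := hWW i k' e x h2 h2'; exact h3 n hn e
    · exact h3 n' h3' h4'
    · obtain ⟨n, hn, e⟩ := hWW i j hij x h2 h2'; exact h3 n hn e
  have MM : ∀ i j, i + 1 < a → j + 1 < a → i < j → ∀ x ∈ M i, x ∉ M j := by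
    intro i j h1 h2 hij x hx hy
    obtain ⟨-, -, -, -, -, -, -, -, -, -, -, -, -, -, v3, -⟩ := hd i h1
    obtain ⟨-, -, -, -, -, -, -, -, -, -, -, -, -, -, v3', -⟩ := hd j h2
    obtain ⟨n, hn, rfl⟩ := hWW i j hij.ne x (v3 _ hx) (v3' _ hy)
    have e1 := hWsp i h1 n hn (v3 _ hx)
    have e2 := hWsp j h2 n hn (v3' _ hy)
    have := hmono i j hij (by omega)
    have := hlen j (by omega)
    omega
  have QM : ∀ i j, i < a → j + 1 < a → ∀ x ∈ Q i, x ∈ M j →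
      (j = i ∧ x = t i) ∨ (i = j + 1 ∧ x = s i) := by
    intro i j h1 h2 x hx hy
    obtain ⟨-, -, -, -, -, -, -, -, -, -, -, -, -, -, v3, x1, x2⟩ := hd j h2
    have hxW := v3 x hy
    have toT : j = i → x ∈ w (hi j) :: B0 j → (j = i ∧ x = t i) ∨ (i = j + 1 ∧ x = s i) := by
      rintro rfl h
      left; exact ⟨rfl, by simp only [t, h2, if_true]; exact x2 x h hy⟩
    have toS : i = j + 1 → x ∈ A0 j ++ [w (hi j + 1)] →
        (j = i ∧ x = t i) ∨ (i = j + 1 ∧ x = s i) := by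
      rintro rfl h
      right; exact ⟨rfl, by simp [s]; exact x1 x h hy⟩
    rcases Qmem i h1 x hx with ⟨k, rfl, q1, q2, q3⟩ | ⟨n, q1, q2, q3, rfl⟩ | ⟨q0, q1, q2, q3⟩
    · by_cases e : k = j
      · subst e; exact toS rfl (List.mem_append_left _ q1)
      · obtain ⟨n, hn, e⟩ := hWW k j e x q2 hxW; exact absurd e (q3 n hn)
    · have l1 := hlen j (by omega)
      have l2 := hlen (j + 1) h2
      have l3 := hstep j h2
      rcases hWsp j h2 n q3 hxW with e | e
      · subst e
        refine toT ?_ (by simp)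
        rcases lt_trichotomy i j with h | h | h
        · have := hmono i j h (by omega); omega
        · exact h.symm
        · have := hmono j i h h1; omega
      · subst e
        refine toS ?_ (by simp)
        rcases lt_trichotomy i (j + 1) with h | h | h
        · have := hmono i (j + 1) h h2; omega
        · exact h
        · have := hmono (j + 1) i h h1; omega
    · by_cases e : i = j
      · subst e; exact toT rfl (List.mem_cons_of_mem _ q1)
      · obtain ⟨n, hn, e⟩ := hWW i j e x q2 hxW; exact absurd e (q3 n hn)
  have Qnd : ∀ i, i < a → (Q i).Nodup := by
    intro i h
    have nA := (List.nodup_append.1 (hA i h).2.1).1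
    have nB := (List.nodup_cons.1 (hB i h).2.1).2
    simp only [Q]
    rw [List.nodup_append, List.nodup_append]
    refine ⟨⟨nA, Snd i h, ?_⟩, nB, ?_⟩
    · rintro x hx y hy rfl
      obtain ⟨j, rfl, h1, h2⟩ := Amem i h x hx
      obtain ⟨n, q1, q2, q3⟩ := (memS _ h x).1 hy
      exact A0sp j h x h1 n (q2.trans (hile _ h)) q3
    · rintro x hx y hy rfl
      obtain ⟨p1, p2, p3⟩ := Bmem i h x hy
      rcases List.mem_append.1 hx with hx | hx
      · obtain ⟨j, rfl, h1, h2⟩ := Amem i h x hx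
        obtain ⟨n, hn, e⟩ := hWW j (j + 1) (by omega) x h2 p3
        exact A0sp j h x h1 n hn e
      · obtain ⟨n, q1, q2, q3⟩ := (memS _ h x).1 hx
        exact B0sp i p1 x p2 n (q2.trans (hile _ h)) q3
  have Qch : ∀ i, i < a → (Q i).IsChain C.arcs := by
    intro i h
    simp only [Q]
    have cA := List.isChain_append.1 (hA i h).1
    have cB := List.isChain_cons.1 (hB i h).1
    rw [List.isChain_append, List.isChain_append]
    refine ⟨⟨cA.1, Sch i h, ?_⟩, cB.2, ?_⟩
    · intro x hx y hy
      rw [Shead] at hy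
      exact cA.2.2 x hx y (by simpa using hy)
    · intro x hx y hy
      rw [List.getLast?_append, Slast i h] at hx
      simp at hx; subst hx
      exact cB.1 y hy
  have Qhead : ∀ i, i < a → (Q i).head? = some (s i) := by
    intro i h
    rw [← (hA i h).2.2]
    simp [Q, List.head?_append, Shead]
  have Qlast : ∀ i, i < a → (Q i).getLast? = some (t i) := by
    intro i h
    rw [← (hB i h).2.2]
    simp only [Q]
    rw [List.getLast?_append, List.getLast?_append, Slast i h, List.getLast?_cons]
    cases (B i).getLast? <;> simp
  have Qlen : ∀ i, i < a → b + 1 ≤ (Q i).length := by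
    intro i h
    have := Slen i h
    simp only [Q, List.length_append]; omega
  have Qne : ∀ i, i < a → Q i ≠ [] := by
    intro i h e; have := Qlen i h; rw [e] at this; simp at this
  refine ⟨{ s := fun i => s i, t := fun i => t i, Q := fun i => Q i, Q' := fun i => M i
            path_Q := fun i => ⟨Qne i i.isLt, Qnd i i.isLt, Qch i i.isLt⟩
            first_Q := fun i => Qhead i i.isLt
            last_Q := fun i => Qlast i i.isLt
            path_Q' := ?_
            first_Q' := ?_
            last_Q' := ?_
            len_Q := fun i _ _ => Qlen i i.isLt
            len_Q' := ?_
            disj_QQ := fun i j hij => QQ i j i.isLt j.isLt (fun h => hij (Fin.ext h))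
            disj_Q'Q' := ?_
            disj_QQ' := fun i j => QM i j i.isLt (by omega) }, fun i => Qlen i i.isLt, ?_, ?_⟩
  · intro i
    obtain ⟨c1, c2, c3, n1, n2, n3, d, h1, h2, h3, h4, l, -⟩ := hd i (by omega)
    exact ⟨by intro e; rw [e] at l; simp at l, n3, c3⟩
  · intro i
    obtain ⟨c1, c2, c3, n1, n2, n3, d, h1, h2, h3, h4, l, -⟩ := hd i (by omega)
    simpa [s] using h3
  · intro i
    have hi' : (i : ℕ) + 1 < a := by omega
    obtain ⟨c1, c2, c3, n1, n2, n3, d, h1, h2, h3, h4, l, -⟩ := hd i hi'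
    simpa [t, hi'] using h4
  · intro i
    obtain ⟨c1, c2, c3, n1, n2, n3, d, h1, h2, h3, h4, l, -⟩ := hd i (by omega)
    exact l
  · intro i j hij x hx hy
    rcases lt_or_gt_of_ne (fun h => hij (Fin.ext h) : (i : ℕ) ≠ j) with h | h
    · exact MM i j (by omega) (by omega) h x hx hy
    · exact MM j i (by omega) (by omega) h x hy hx
  · simp [s, hw0]
  · have : ¬ (a - 1 + 1 < a) := by omega
    simp [t, this, hwm]

end Paper

namespace Paper

/-- Every chain with `|A₂| ≥ a(b+1) − 1` contains a strong
`(a,b)`-alternating path `R` with `s_1(R) = v_0` and `t_a(R) = v_m`. -/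
theorem stmt_10 {V : Type*} [Fintype V] (D : V → V → Prop) (hloop : ∀ v, ¬ D v v)
    (a b m : ℕ) (ha : 1 ≤ a) (hb : 1 ≤ b) (C : GChain D b m)
    (hA2 : a * (b + 1) - 1 ≤ C.A2.card) :
    ∃ R : AltPath C.arcs a b, R.Strong ∧
      R.s ⟨0, ha⟩ = C.v 0 ∧ R.t ⟨a - 1, by omega⟩ = C.v (Fin.last m) := by
  exact main_aux_s10 D a b m ha hb C (Nat.sub_lt ha Nat.one_pos) hA2

end Paper
end
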